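/- arXiv:1908.08481 — 10 statements merged into one kernel-verified Lean document; each statement's English description precedes it below -/
import Mathlib

section
/- For a delineated abstract scattering representation of a non-lazy Markov transition matrix, the transition probabilities within a scattering class have the product form: if a and b lie in the same scattering class E and a ≺ b, then p a b̃ = ω_{a,+} · (∏_{z ∈ E, a ≺ z ≺ b} (1 − s z̃)) · s b̃, while if b ≺ a then p a b̃ = ω_{a,−} · (∏_{z ∈ E, b ≺ z ≺ a} (1 − s z̃)) · s b̃. -/
open scoped BigOperators

namespace Scatter

variable {S : Type*}

/-- Infinite product over a subset, interpreted as the infimum of finite subproducts. -/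
noncomputable def infProd (A : Set S) (f : S → ℝ) : ℝ :=
  ⨅ F : {F : Finset S // ↑F ⊆ A}, ∏ z ∈ F.1, f z

/-- An abstract scattering representation of a non-lazy Markov transition matrix,
together with a fixed-point-free involution `inv` with `p a (inv a) = 0`. -/
structure Rep (S : Type*) where
  p : S → S → ℝ
  s : S → ℝ
  ω : S → S → ℝ
  inv : S → S
  p_nonneg : ∀ a b, 0 ≤ p a b
  p_rowSum : ∀ a, HasSum (p a) 1
  p_diag : ∀ a, p a a = 0
  s_pos : ∀ a, 0 < s a
  s_le_one : ∀ a, s a ≤ 1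
  ω_nonneg : ∀ a b, 0 ≤ ω a b
  ω_le_one : ∀ a b, ω a b ≤ 1
  ω_diag : ∀ a, ω a a = 0
  p_eq : ∀ a b, p a b = ω a b * s b
  inv_inv : ∀ a, inv (inv a) = a
  inv_ne : ∀ a, inv a ≠ a
  p_inv : ∀ a, p a (inv a) = 0

/-- Two states lie in the same scattering class: the equivalence relation generated by
relating `a` and `b` whenever `ω a (inv b) > 0` or `ω b (inv a) > 0`. -/
def Rep.same (R : Rep S) : S → S → Prop :=
  Relation.EqvGen fun a b => 0 < R.ω a (R.inv b) ∨ 0 < R.ω b (R.inv a)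

/-- A delineation: a strict order which is a linear order on each scattering class,
compatible with the scattering representation. -/
structure Delineation (R : Rep S) where
  lt : S → S → Prop
  irrefl : ∀ a, ¬ lt a a
  trans : ∀ a b c, lt a b → lt b c → lt a c
  total : ∀ a b, R.same a b → a = b ∨ lt a b ∨ lt b a
  compat_sum : ∀ a b c, R.same a b → R.same b c → lt a b → lt b c →
    R.ω b (R.inv a) + R.ω b (R.inv c) ≤ 1
  compat_mono : ∀ a b c, R.same a b → R.same b c →
    ((lt a b ∧ lt b c) ∨ (lt c b ∧ lt b a)) →
    R.ω a (R.inv c) ≤ R.ω a (R.inv b) * (1 - R.s (R.inv b))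

/-- Limiting transmission probability in the `+` direction. -/
noncomputable def Delineation.ωplus {R : Rep S} (D : Delineation R) (a : S) : ℝ :=
  sSup {x | ∃ b, R.same a b ∧ D.lt a b ∧ x = R.ω a (R.inv b)}

/-- Limiting transmission probability in the `−` direction. -/
noncomputable def Delineation.ωminus {R : Rep S} (D : Delineation R) (a : S) : ℝ :=
  sSup {x | ∃ b, R.same a b ∧ D.lt b a ∧ x = R.ω a (R.inv b)}

/-- Dynamical detailed balance with invariant measure `π`. -/
structure DetailedBalance (R : Rep S) where
  π : S → ℝ
  π_pos : ∀ a, 0 < π a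
  π_inv : ∀ a, π (R.inv a) = π a
  balance : ∀ a b, π a * R.p a (R.inv b) = π b * R.p b (R.inv a)

/-- Unbiasedness of the scattering representation. -/
def Rep.Unbiased (R : Rep S) : Prop :=
  ∀ a b, R.ω a (R.inv b) = R.ω b (R.inv a)

end Scatter

namespace Scatter

theorem exists_max_rel {S : Type*} (r : S → S → Prop) (A : Set S)
    (htr : ∀ a b c, r a b → r b c → r a c)
    (htot : ∀ a ∈ A, ∀ b ∈ A, a = b ∨ r a b ∨ r b a) (F : Finset S) :
    ↑F ⊆ A → F.Nonempty → ∃ m ∈ F, ∀ z ∈ F, z = m ∨ r z m := by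
  classical
  induction F using Finset.induction_on with
  | empty => intro _ h; exact absurd h (by simp)
  | insert x F hx ih =>
    intro hF _
    have hF' : ↑F ⊆ A := fun z hz => hF (by simp at hz ⊢; exact Or.inr hz)
    have hxA : x ∈ A := hF (by simp)
    rcases F.eq_empty_or_nonempty with h0 | h0
    · subst h0
      exact ⟨x, by simp, by simp⟩
    · obtain ⟨m, hm, hmax⟩ := ih hF' h0
      rcases htot x hxA m (hF' hm) with h | h | h
      · exact absurd (h ▸ hm) hx
      · refine ⟨m, by simp [hm], fun z hz => ?_⟩
        rcases Finset.mem_insert.1 hz with rfl | hz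
        · exact Or.inr h
        · exact hmax z hz
      · refine ⟨x, by simp, fun z hz => ?_⟩
        rcases Finset.mem_insert.1 hz with rfl | hz
        · exact Or.inl rfl
        · rcases hmax z hz with rfl | h'
          · exact Or.inr h
          · exact Or.inr (htr _ _ _ h' h)

theorem induction_rel {S : Type*} (r : S → S → Prop) (A : Set S)
    (hirr : ∀ a, ¬ r a a)
    (htr : ∀ a b c, r a b → r b c → r a c)
    (htot : ∀ a ∈ A, ∀ b ∈ A, a = b ∨ r a b ∨ r b a) (P : Finset S → Prop)
    (h0 : P ∅)
    (hs : ∀ (F : Finset S) (m : S) (hm : m ∉ F), ↑F ⊆ A → m ∈ A → (∀ z ∈ F, r z m) → P F →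
      P (Finset.cons m F hm)) (F : Finset S) (hF : ↑F ⊆ A) : P F := by
  classical
  induction F using Finset.strongInduction with
  | H F ih =>
    rcases F.eq_empty_or_nonempty with rfl | hne
    · exact h0
    · obtain ⟨m, hm, hmax⟩ := exists_max_rel r A htr htot F hF hne
      have hsub : ↑(F.erase m) ⊆ A := fun z hz => hF (Finset.mem_of_mem_erase hz)
      have := hs (F.erase m) m (by simp) hsub (hF hm)
        (fun z hz => (hmax z (Finset.mem_of_mem_erase hz)).resolve_left (Finset.ne_of_mem_erase hz))
        (ih _ (Finset.erase_ssubset hm) hsub)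
      rwa [Finset.cons_eq_insert, Finset.insert_erase hm] at this

theorem le_prod_rel {S : Type*} (r : S → S → Prop) (A : Set S)
    (hirr : ∀ a, ¬ r a a)
    (htr : ∀ a b c, r a b → r b c → r a c)
    (htot : ∀ a ∈ A, ∀ b ∈ A, a = b ∨ r a b ∨ r b a) (g s : S → ℝ) (W : ℝ)
    (hs1 : ∀ z, s z ≤ 1) (hgW : ∀ z ∈ A, g z ≤ W)
    (hmono : ∀ b ∈ A, ∀ c ∈ A, r b c → g c ≤ g b * (1 - s b))
    (F : Finset S) (hF : ↑F ⊆ A) : ∀ c ∈ A, (∀ z ∈ F, r z c) → g c ≤ W * ∏ z ∈ F, (1 - s z) := by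
  refine induction_rel r A hirr htr htot
    (fun F => ∀ c ∈ A, (∀ z ∈ F, r z c) → g c ≤ W * ∏ z ∈ F, (1 - s z)) ?_ ?_ F hF
  · intro c hc _
    simpa using hgW c hc
  · intro F m hm hFA hmA hmax ih c hc hlt
    have h1 := hmono m hmA c hc (hlt m (by simp))
    have h2 := ih m hmA hmax
    have h3 := mul_le_mul_of_nonneg_right h2 (sub_nonneg.2 (hs1 m))
    rw [Finset.prod_cons]
    linarith

theorem sum_le_rel {S : Type*} (r : S → S → Prop) (A : Set S)
    (hirr : ∀ a, ¬ r a a)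
    (htr : ∀ a b c, r a b → r b c → r a c)
    (htot : ∀ a ∈ A, ∀ b ∈ A, a = b ∨ r a b ∨ r b a) (g s : S → ℝ) (W : ℝ)
    (hs0 : ∀ z, 0 ≤ s z)
    (hs1 : ∀ z, s z ≤ 1) (hgW : ∀ z ∈ A, g z ≤ W)
    (hmono : ∀ b ∈ A, ∀ c ∈ A, r b c → g c ≤ g b * (1 - s b))
    (F : Finset S) (hF : ↑F ⊆ A) : ∑ z ∈ F, g z * s z ≤ W * (1 - ∏ z ∈ F, (1 - s z)) := by
  refine induction_rel r A hirr htr htot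
    (fun F => ∑ z ∈ F, g z * s z ≤ W * (1 - ∏ z ∈ F, (1 - s z))) ?_ ?_ F hF
  · simp
  · intro F m hm hFA hmA hmax ih
    have h2 := le_prod_rel r A hirr htr htot g s W hs1 hgW hmono F hFA m hmA hmax
    have h3 := mul_le_mul_of_nonneg_right h2 (hs0 m)
    rw [Finset.prod_cons, Finset.sum_cons]
    linarith

theorem core_rel {S : Type*} (r : S → S → Prop) (A B : Set S)
    (hirr : ∀ a, ¬ r a a)
    (htr : ∀ a b c, r a b → r b c → r a c)
    (htot : ∀ a ∈ A, ∀ b ∈ A, a = b ∨ r a b ∨ r b a) (g s : S → ℝ) (W V : ℝ)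
    (hg0 : ∀ z, 0 ≤ g z) (hW : 0 ≤ W) (hV : 0 ≤ V)
    (hs0 : ∀ z, 0 ≤ s z)
    (hs1 : ∀ z, s z ≤ 1) (hgW : ∀ z ∈ A, g z ≤ W)
    (hmono : ∀ b ∈ A, ∀ c ∈ A, r b c → g c ≤ g b * (1 - s b))
    (hsum : HasSum (fun z => g z * s z) 1)
    (hz : ∀ z, z ∉ A → z ∉ B → g z = 0)
    (hB : ∀ F : Finset S, ↑F ⊆ B → ∑ z ∈ F, g z * s z ≤ V)
    (hWV : W + V ≤ 1) (b : S) (hb : b ∈ A) (C : Set S) (hC : ∀ z, z ∈ C ↔ z ∈ A ∧ r z b) :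
    g b = W * infProd C (fun z => 1 - s z) := by
  classical
  haveI : Nonempty {F : Finset S // ↑F ⊆ C} := ⟨⟨∅, by simp⟩⟩
  apply le_antisymm
  · unfold infProd
    rw [Real.mul_iInf_of_nonneg hW]
    apply le_ciInf
    rintro ⟨F, hF⟩
    exact le_prod_rel r A hirr htr htot g s W hs1 hgW hmono F
      (fun z hz => ((hC z).1 (hF hz)).1) b hb (fun z hz => ((hC z).1 (hF hz)).2)
  · apply le_of_forall_pos_le_add
    intro ε hε
    obtain ⟨F, hF⟩ := (hsum.eventually (lt_mem_nhds (show 1 - ε < 1 by linarith))).exists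
    have hle : ∑ z ∈ F, g z * s z ≤ ∑ z ∈ F with z ∈ C, g z * s z
        + ∑ z ∈ F with (z ∈ A ∧ (z = b ∨ r b z)), g z * s z + ∑ z ∈ F with z ∈ B, g z * s z := by
      simp only [Finset.sum_filter, ← Finset.sum_add_distrib]
      apply Finset.sum_le_sum
      intro z _
      have h0 := mul_nonneg (hg0 z) (hs0 z)
      have hh : z ∈ C ∨ (z ∈ A ∧ (z = b ∨ r b z)) ∨ z ∈ B ∨ g z = 0 := by
        by_cases hA : z ∈ A
        · rcases htot z hA b hb with h | h | h
          · exact Or.inr (Or.inl ⟨hA, Or.inl h⟩)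
          · exact Or.inl ((hC z).2 ⟨hA, h⟩)
          · exact Or.inr (Or.inl ⟨hA, Or.inr h⟩)
        · by_cases hB' : z ∈ B
          · exact Or.inr (Or.inr (Or.inl hB'))
          · exact Or.inr (Or.inr (Or.inr (hz z hA hB')))
      rcases hh with h | h | h | h
      · rw [if_pos h]; split_ifs <;> linarith
      · rw [if_pos h]; split_ifs <;> linarith
      · rw [if_pos h]; split_ifs <;> linarith
      · simp [h]
    have h1 := sum_le_rel r A hirr htr htot g s W hs0 hs1 hgW hmono (F.filter (· ∈ C))
      (fun z hz => ((hC z).1 (by simpa using (Finset.mem_filter.1 hz).2)).1)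
    have h2 := sum_le_rel r {z | z ∈ A ∧ (z = b ∨ r b z)} hirr htr
      (fun x hx y hy => htot x hx.1 y hy.1) g s (g b) hs0 hs1
      (by
        rintro z ⟨hzA, rfl | h⟩
        · exact le_rfl
        · have := hmono b hb z hzA h
          nlinarith [mul_nonneg (hg0 b) (hs0 b)])
      (fun x hx y hy => hmono x hx.1 y hy.1) (F.filter fun z => z ∈ A ∧ (z = b ∨ r b z))
      (fun z hz => (Finset.mem_filter.1 hz).2)
    have h2' : 0 ≤ g b * ∏ z ∈ F with (z ∈ A ∧ (z = b ∨ r b z)), (1 - s z) :=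
      mul_nonneg (hg0 b) (Finset.prod_nonneg fun z _ => sub_nonneg.2 (hs1 z))
    have h3 := hB (F.filter (· ∈ B)) (fun z hz => (Finset.mem_filter.1 hz).2)
    have h4 : infProd C (fun z => 1 - s z) ≤ ∏ z ∈ F with z ∈ C, (1 - s z) := by
      unfold infProd
      refine ciInf_le (f := fun F : {F : Finset S // ↑F ⊆ C} => ∏ z ∈ F.1, (1 - s z)) ?_
        ⟨F.filter (· ∈ C), fun z hz => (Finset.mem_filter.1 hz).2⟩
      refine ⟨0, ?_⟩
      rintro _ ⟨F, rfl⟩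
      exact Finset.prod_nonneg fun z _ => sub_nonneg.2 (hs1 z)
    have h5 := mul_le_mul_of_nonneg_left h4 hW
    linarith

theorem sSup_add_le (X Y : Set ℝ) (hX : ∀ x ∈ X, x ≤ 1) (hY : ∀ x ∈ Y, x ≤ 1)
    (h : ∀ x ∈ X, ∀ y ∈ Y, x + y ≤ 1) : sSup X + sSup Y ≤ 1 := by
  rcases X.eq_empty_or_nonempty with rfl | hXn
  · simpa using Real.sSup_le hY zero_le_one
  rcases Y.eq_empty_or_nonempty with rfl | hYn
  · simpa using Real.sSup_le hX zero_le_one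
  have : sSup X ≤ 1 - sSup Y := csSup_le hXn fun x hx => by
    have : sSup Y ≤ 1 - x := csSup_le hYn fun y hy => by linarith [h x hx y hy]
    linarith
  linarith

end Scatter

/-- Theorem `thm:delineated`, product form of transition probabilities.
For a delineated abstract scattering representation of a non-lazy Markov transition matrix,
if `a` and `b` lie in the same scattering class then `p a b̃` has the stated product form,
according as `a ≺ b` or `b ≺ a`. -/
theorem stmt0 {S : Type*} [Countable S] (R : Scatter.Rep S) (D : Scatter.Delineation R)
    (a b : S) (hab : R.same a b) :
    (D.lt a b → R.p a (R.inv b) =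
      D.ωplus a *
        Scatter.infProd {z | R.same a z ∧ D.lt a z ∧ D.lt z b}
          (fun z => 1 - R.s (R.inv z)) * R.s (R.inv b)) ∧
    (D.lt b a → R.p a (R.inv b) =
      D.ωminus a *
        Scatter.infProd {z | R.same a z ∧ D.lt b z ∧ D.lt z a}
          (fun z => 1 - R.s (R.inv z)) * R.s (R.inv b)) := by
  have symm : ∀ {x y}, R.same x y → R.same y x := fun h => Relation.EqvGen.symm _ _ h
  have tr : ∀ {x y z}, R.same x y → R.same y z → R.same x z :=
    fun h h' => Relation.EqvGen.trans _ _ _ h h'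
  set g : S → ℝ := fun z => R.ω a (R.inv z) with hg
  set s : S → ℝ := fun z => R.s (R.inv z) with hs
  set A : Set S := {z | R.same a z ∧ D.lt a z} with hA
  set B : Set S := {z | R.same a z ∧ D.lt z a} with hB
  have hg0 : ∀ z, 0 ≤ g z := fun z => R.ω_nonneg _ _
  have hg1 : ∀ z, g z ≤ 1 := fun z => R.ω_le_one _ _
  have hs0 : ∀ z, 0 ≤ s z := fun z => (R.s_pos _).le
  have hs1 : ∀ z, s z ≤ 1 := fun z => R.s_le_one _
  have hsum : HasSum (fun z => g z * s z) 1 := by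
    have h := (Equiv.hasSum_iff (Function.Involutive.toPerm R.inv R.inv_inv)).2 (R.p_rowSum a)
    convert h using 1
    funext z
    exact (R.p_eq _ _).symm
  have hz : ∀ z, z ∉ A → z ∉ B → g z = 0 := by
    intro z h1 h2
    by_contra hne
    have hpos : 0 < R.ω a (R.inv z) := lt_of_le_of_ne (hg0 z) (Ne.symm hne)
    have hsame : R.same a z := Relation.EqvGen.rel _ _ (Or.inl hpos)
    rcases D.total a z hsame with h | h | h
    · subst h
      have h3 := R.p_inv a
      rw [R.p_eq] at h3
      exact absurd h3 (mul_pos hpos (R.s_pos _)).ne'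
    · exact h1 ⟨hsame, h⟩
    · exact h2 ⟨hsame, h⟩
  have totA : ∀ x ∈ A, ∀ y ∈ A, x = y ∨ D.lt x y ∨ D.lt y x :=
    fun x hx y hy => D.total x y (tr (symm hx.1) hy.1)
  have totB : ∀ x ∈ B, ∀ y ∈ B, x = y ∨ D.lt y x ∨ D.lt x y :=
    fun x hx y hy => (D.total x y (tr (symm hx.1) hy.1)).imp id Or.symm
  have monoA : ∀ x ∈ A, ∀ y ∈ A, D.lt x y → g y ≤ g x * (1 - s x) :=
    fun x hx y hy h => D.compat_mono a x y hx.1 (tr (symm hx.1) hy.1) (Or.inl ⟨hx.2, h⟩)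
  have monoB : ∀ x ∈ B, ∀ y ∈ B, D.lt y x → g y ≤ g x * (1 - s x) :=
    fun x hx y hy h => D.compat_mono a x y hx.1 (tr (symm hx.1) hy.1) (Or.inr ⟨h, hx.2⟩)
  have hWA : ∀ z ∈ A, g z ≤ D.ωplus a := fun z hz => le_csSup
    ⟨1, by rintro _ ⟨y, _, _, rfl⟩; exact hg1 y⟩ ⟨z, hz.1, hz.2, rfl⟩
  have hWB : ∀ z ∈ B, g z ≤ D.ωminus a := fun z hz => le_csSup
    ⟨1, by rintro _ ⟨y, _, _, rfl⟩; exact hg1 y⟩ ⟨z, hz.1, hz.2, rfl⟩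
  have hW0 : 0 ≤ D.ωplus a := Real.sSup_nonneg (by rintro _ ⟨y, _, _, rfl⟩; exact hg0 y)
  have hV0 : 0 ≤ D.ωminus a := Real.sSup_nonneg (by rintro _ ⟨y, _, _, rfl⟩; exact hg0 y)
  have hWV : D.ωplus a + D.ωminus a ≤ 1 := by
    apply Scatter.sSup_add_le
    · rintro _ ⟨y, _, _, rfl⟩; exact hg1 y
    · rintro _ ⟨y, _, _, rfl⟩; exact hg1 y
    · rintro _ ⟨x, hx, hx', rfl⟩ _ ⟨y, hy, hy', rfl⟩
      linarith [D.compat_sum y a x (symm hy) hx hy' hx']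
  have trans' : ∀ x y z, D.lt y x → D.lt z y → D.lt z x := fun x y z h h' => D.trans _ _ _ h' h
  have sumA : ∀ F : Finset S, ↑F ⊆ A → ∑ z ∈ F, g z * s z ≤ D.ωplus a := by
    intro F hF
    have h1 := Scatter.sum_le_rel D.lt A D.irrefl D.trans totA g s _ hs0 hs1 hWA monoA F hF
    have h2 : 0 ≤ D.ωplus a * ∏ z ∈ F, (1 - s z) :=
      mul_nonneg hW0 (Finset.prod_nonneg fun z _ => sub_nonneg.2 (hs1 z))
    linarith
  have sumB : ∀ F : Finset S, ↑F ⊆ B → ∑ z ∈ F, g z * s z ≤ D.ωminus a := by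
    intro F hF
    have h1 := Scatter.sum_le_rel (fun x y => D.lt y x) B D.irrefl trans' totB g s _
      hs0 hs1 hWB monoB F hF
    have h2 : 0 ≤ D.ωminus a * ∏ z ∈ F, (1 - s z) :=
      mul_nonneg hV0 (Finset.prod_nonneg fun z _ => sub_nonneg.2 (hs1 z))
    linarith
  constructor
  · intro hlt
    rw [R.p_eq]
    congr 1
    exact Scatter.core_rel D.lt A B D.irrefl D.trans totA g s _ _ hg0 hW0 hV0 hs0 hs1 hWA monoA
      hsum hz sumB hWV b ⟨hab, hlt⟩ _ (fun z => by simp [hA, and_assoc])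
  · intro hlt
    rw [R.p_eq]
    congr 1
    exact Scatter.core_rel (fun x y => D.lt y x) B A D.irrefl trans' totB g s _ _ hg0 hV0 hW0
      hs0 hs1 hWB monoB hsum (fun z h h' => hz z h' h) sumA (by linarith) b ⟨hab, hlt⟩ _
      (fun z => by simp only [hB, Set.mem_setOf_eq]; tauto)
end

section
/- For a delineated abstract scattering representation of a non-lazy Markov transition matrix, every state a satisfies ω_{a,−} + ω_{a,+} = 1; that is, the limiting transmission probabilities in the two directions along the scattering class of a sum to one. -/
open scoped BigOperators

theorem Scatter.sum_le_aux {S : Type*} (w t : S → ℝ) (hw : ∀ b, 0 ≤ w b)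
    (ht : ∀ b, 0 < t b) (ht1 : ∀ b, t b ≤ 1) :
    ∀ (n : ℕ) (F : Finset S), F.card = n →
      (∀ b ∈ F, ∀ c ∈ F, b ≠ c → w c ≤ w b * (1 - t b) ∨ w b ≤ w c * (1 - t c)) →
      ∀ M : ℝ, 0 ≤ M → (∀ b ∈ F, w b ≤ M) → ∑ b ∈ F, w b * t b ≤ M := by
  classical
  intro n
  induction n with
  | zero =>
    intro F hF _ M hM _
    rw [Finset.card_eq_zero.mp hF]
    simpa using hM
  | succ n ih =>
    intro F hF hrel M hM hb
    have hne : F.Nonempty := by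
      rw [← Finset.card_pos]; omega
    obtain ⟨m, hm, hmax⟩ := Finset.exists_max_image F w hne
    have h0 : 0 ≤ w m * (1 - t m) := mul_nonneg (hw m) (by linarith [ht1 m])
    have hrec := ih (F.erase m) (by rw [Finset.card_erase_of_mem hm]; omega)
      (fun b hb c hc hbc => hrel b (Finset.mem_of_mem_erase hb) c (Finset.mem_of_mem_erase hc) hbc)
      (w m * (1 - t m)) h0 (by
        intro c hc
        have hcF := Finset.mem_of_mem_erase hc
        rcases hrel m hm c hcF (Finset.ne_of_mem_erase hc).symm with h | h
        · exact h
        · have h1 := hmax c hcF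
          have h2 : w c * (1 - t c) ≤ w m * (1 - t c) :=
            mul_le_mul_of_nonneg_right h1 (by linarith [ht1 c])
          have h3 : w m = 0 := by
            by_contra hne0
            have hpos : 0 < w m := lt_of_le_of_ne (hw m) (Ne.symm hne0)
            nlinarith [mul_pos hpos (ht c)]
          rw [h3] at h1 ⊢
          simpa using h1)
    rw [← Finset.add_sum_erase F _ hm]
    have := hb m hm
    linarith

/-- Theorem `thm:delineated`: for a delineated abstract scattering
representation of a non-lazy Markov transition matrix, the limiting transmission
probabilities in the two directions sum to one: `ω_{a,−} + ω_{a,+} = 1` for every state. -/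
theorem stmt1 {S : Type*} [Countable S] (R : Scatter.Rep S) (D : Scatter.Delineation R)
    (a : S) :
    D.ωminus a + D.ωplus a = 1 := by
  classical
  have same_trans : ∀ {x y z}, R.same x y → R.same y z → R.same x z :=
    fun h1 h2 => Relation.EqvGen.trans _ _ _ h1 h2
  have same_symm : ∀ {x y}, R.same x y → R.same y x :=
    fun h => Relation.EqvGen.symm _ _ h
  have bddP : BddAbove {x | ∃ b, R.same a b ∧ D.lt a b ∧ x = R.ω a (R.inv b)} :=
    ⟨1, by rintro _ ⟨b, _, _, rfl⟩; exact R.ω_le_one _ _⟩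
  have bddM : BddAbove {x | ∃ b, R.same a b ∧ D.lt b a ∧ x = R.ω a (R.inv b)} :=
    ⟨1, by rintro _ ⟨b, _, _, rfl⟩; exact R.ω_le_one _ _⟩
  have plus_nonneg : 0 ≤ D.ωplus a :=
    Real.sSup_nonneg (by rintro _ ⟨b, _, _, rfl⟩; exact R.ω_nonneg _ _)
  have minus_nonneg : 0 ≤ D.ωminus a :=
    Real.sSup_nonneg (by rintro _ ⟨b, _, _, rfl⟩; exact R.ω_nonneg _ _)
  apply le_antisymm
  · -- upper bound
    by_cases hP : ∃ c, R.same a c ∧ D.lt a c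
    · obtain ⟨c0, hc0, hc0'⟩ := hP
      have key : ∀ c, R.same a c → D.lt a c → R.ω a (R.inv c) ≤ 1 - D.ωminus a := by
        intro c hc hlt
        have : D.ωminus a ≤ 1 - R.ω a (R.inv c) := by
          apply Real.sSup_le
          · rintro _ ⟨b, hb, hbl, rfl⟩
            have := D.compat_sum b a c (same_symm hb) hc hbl hlt
            linarith
          · linarith [R.ω_le_one a (R.inv c)]
        linarith
      have : D.ωplus a ≤ 1 - D.ωminus a := by
        apply Real.sSup_le
        · rintro _ ⟨b, hb, hbl, rfl⟩
          exact key b hb hbl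
        · exact (R.ω_nonneg _ _).trans (key c0 hc0 hc0')
      linarith
    · have h1 : D.ωplus a ≤ 0 := by
        apply Real.sSup_le
        · rintro _ ⟨b, hb, hbl, rfl⟩
          exact absurd ⟨b, hb, hbl⟩ hP
        · exact le_rfl
      have h2 : D.ωminus a ≤ 1 := by
        apply Real.sSup_le
        · rintro _ ⟨b, hb, hbl, rfl⟩
          exact R.ω_le_one _ _
        · exact zero_le_one
      linarith
  · -- lower bound
    let e : S ≃ S := ⟨R.inv, R.inv, R.inv_inv, R.inv_inv⟩
    have hs : HasSum (fun b => R.p a (R.inv b)) 1 := by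
      have := (e.hasSum_iff (f := R.p a) (a := 1)).mpr (R.p_rowSum a)
      exact this
    refine hasSum_le_of_sum_le hs ?_
    intro F
    have split : ∀ b ∈ F, R.p a (R.inv b) ≤
        (if R.same a b ∧ D.lt b a then R.ω a (R.inv b) * R.s (R.inv b) else 0) +
        (if R.same a b ∧ D.lt a b then R.ω a (R.inv b) * R.s (R.inv b) else 0) := by
      intro b _
      have hnn : 0 ≤ R.ω a (R.inv b) * R.s (R.inv b) :=
        mul_nonneg (R.ω_nonneg _ _) (R.s_pos _).le
      by_cases h0 : R.p a (R.inv b) = 0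
      · rw [h0]
        split_ifs <;> linarith
      · have hpe := R.p_eq a (R.inv b)
        have hω : 0 < R.ω a (R.inv b) := by
          refine lt_of_le_of_ne (R.ω_nonneg _ _) (fun h => h0 ?_)
          rw [hpe, ← h, zero_mul]
        have hsame : R.same a b := Relation.EqvGen.rel _ _ (Or.inl hω)
        rcases D.total a b hsame with h | h | h
        · subst h
          exact absurd (R.p_inv a) h0
        · rw [hpe, if_pos (⟨hsame, h⟩ : R.same a b ∧ D.lt a b)]
          split_ifs <;> linarith
        · rw [hpe, if_pos (⟨hsame, h⟩ : R.same a b ∧ D.lt b a)]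
          split_ifs <;> linarith
    refine (Finset.sum_le_sum split).trans ?_
    rw [Finset.sum_add_distrib, ← Finset.sum_filter, ← Finset.sum_filter]
    apply add_le_add
    · refine Scatter.sum_le_aux (fun b => R.ω a (R.inv b)) (fun b => R.s (R.inv b))
        (fun _ => R.ω_nonneg _ _) (fun _ => R.s_pos _) (fun _ => R.s_le_one _) _ _ rfl
        ?_ _ minus_nonneg ?_
      · intro b hb c hc hbc
        obtain ⟨_, hb1, hb2⟩ := Finset.mem_filter.mp hb
        obtain ⟨_, hc1, hc2⟩ := Finset.mem_filter.mp hc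
        have hbc' := same_trans (same_symm hb1) hc1
        rcases D.total b c hbc' with h | h | h
        · exact absurd h hbc
        · exact Or.inr (D.compat_mono a c b hc1 (same_symm hbc') (Or.inr ⟨h, hc2⟩))
        · exact Or.inl (D.compat_mono a b c hb1 hbc' (Or.inr ⟨h, hb2⟩))
      · intro b hb
        obtain ⟨_, hb1, hb2⟩ := Finset.mem_filter.mp hb
        exact le_csSup bddM ⟨b, hb1, hb2, rfl⟩
    · refine Scatter.sum_le_aux (fun b => R.ω a (R.inv b)) (fun b => R.s (R.inv b))
        (fun _ => R.ω_nonneg _ _) (fun _ => R.s_pos _) (fun _ => R.s_le_one _) _ _ rfl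
        ?_ _ plus_nonneg ?_
      · intro b hb c hc hbc
        obtain ⟨_, hb1, hb2⟩ := Finset.mem_filter.mp hb
        obtain ⟨_, hc1, hc2⟩ := Finset.mem_filter.mp hc
        have hbc' := same_trans (same_symm hb1) hc1
        rcases D.total b c hbc' with h | h | h
        · exact absurd h hbc
        · exact Or.inl (D.compat_mono a b c hb1 hbc' (Or.inl ⟨hb2, h⟩))
        · exact Or.inr (D.compat_mono a c b hc1 (same_symm hbc') (Or.inl ⟨hc2, h⟩))
      · intro b hb
        obtain ⟨_, hb1, hb2⟩ := Finset.mem_filter.mp hb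
        exact le_csSup bddP ⟨b, hb1, hb2, rfl⟩
end

section
/- For a delineated abstract scattering representation of a non-lazy Markov transition matrix, eventual scattering occurs with probability one in any direction of positive transmission: if a lies in scattering class E and ω_{a,+} > 0 then ∏_{z ∈ E, a ≺ z} (1 − s z̃) = 0, and if ω_{a,−} > 0 then ∏_{z ∈ E, z ≺ a} (1 − s z̃) = 0. -/
open scoped BigOperators

namespace Scatter

lemma exists_first {S : Type*} (r : S → S → Prop) (A : Set S)
    (htr : ∀ a b c, r a b → r b c → r a c)
    (htot : ∀ x ∈ A, ∀ y ∈ A, x = y ∨ r x y ∨ r y x) (F : Finset S) :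
    F.Nonempty → ↑F ⊆ A → ∃ m ∈ F, ∀ x ∈ F, x ≠ m → r m x := by
  classical
  induction F using Finset.induction_on with
  | empty => intro h; simp at h
  | insert b F hb ih =>
    intro _ hF
    rw [Finset.coe_insert, Set.insert_subset_iff] at hF
    rcases F.eq_empty_or_nonempty with h | h
    · subst h
      exact ⟨b, by simp, by simp⟩
    · obtain ⟨m, hm, hmin⟩ := ih h hF.2
      rcases htot b hF.1 m (hF.2 hm) with h1 | h1 | h1
      · exact absurd (h1 ▸ hm) hb
      · refine ⟨b, by simp, ?_⟩
        intro x hx hxb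
        rcases Finset.mem_insert.1 hx with h2 | h2
        · exact absurd h2 hxb
        · by_cases h3 : x = m
          · exact h3 ▸ h1
          · exact htr _ _ _ h1 (hmin x h2 h3)
      · refine ⟨m, by simp [hm], ?_⟩
        intro x hx hxm
        rcases Finset.mem_insert.1 hx with h2 | h2
        · exact h2 ▸ h1
        · exact hmin x h2 hxm

lemma sum_bound {S : Type*} (r : S → S → Prop) (A : Set S) (w q : S → ℝ)
    (htr : ∀ a b c, r a b → r b c → r a c)
    (htot : ∀ x ∈ A, ∀ y ∈ A, x = y ∨ r x y ∨ r y x)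
    (hq0 : ∀ x, 0 ≤ q x) (hq1 : ∀ x, q x ≤ 1)
    (hw : ∀ b ∈ A, ∀ c ∈ A, r b c → w c ≤ w b * (1 - q b)) (n : ℕ) :
    ∀ (F : Finset S) (W : ℝ), F.card = n → ↑F ⊆ A → (∀ x ∈ F, w x ≤ W) →
      ∑ x ∈ F, w x * q x ≤ W * (1 - ∏ x ∈ F, (1 - q x)) := by
  classical
  induction n with
  | zero =>
    intro F W hc _ _
    rw [Finset.card_eq_zero] at hc
    subst hc; simp
  | succ n ih =>
    intro F W hc hF hW
    obtain ⟨m, hm, hmin⟩ := exists_first r A htr htot F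
      (Finset.card_pos.1 (by omega)) hF
    have h1 := ih (F.erase m) (W * (1 - q m)) (by rw [Finset.card_erase_of_mem hm]; omega)
      (fun x hx => hF (Finset.mem_of_mem_erase hx))
      (fun x hx => (hw m (hF hm) x (hF (Finset.mem_of_mem_erase hx))
        (hmin x (Finset.mem_of_mem_erase hx) (Finset.ne_of_mem_erase hx))).trans
        (mul_le_mul_of_nonneg_right (hW m hm) (by linarith [hq1 m])))
    rw [← Finset.add_sum_erase F _ hm, ← Finset.mul_prod_erase F _ hm]
    have h2 := mul_le_mul_of_nonneg_right (hW m hm) (hq0 m)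
    linarith

lemma infProd_le {S : Type*} (A : Set S) (f : S → ℝ) (hf : ∀ x, 0 ≤ f x) (F : Finset S)
    (hF : ↑F ⊆ A) : infProd A f ≤ ∏ x ∈ F, f x := by
  unfold infProd
  exact ciInf_le (f := fun F : {F : Finset S // ↑F ⊆ A} => ∏ z ∈ F.1, f z)
    ⟨0, by rintro _ ⟨G, rfl⟩; exact Finset.prod_nonneg fun x _ => hf x⟩ ⟨F, hF⟩

lemma infProd_nonneg {S : Type*} (A : Set S) (f : S → ℝ) (hf : ∀ x, 0 ≤ f x) :
    0 ≤ infProd A f :=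
  Real.iInf_nonneg fun _ => Finset.prod_nonneg fun x _ => hf x

end Scatter

open Scatter in
lemma stmt2_key {S : Type*} (R : Scatter.Rep S) (D : Scatter.Delineation R) (a : S) :
    1 ≤ D.ωplus a * (1 - infProd {z | R.same a z ∧ D.lt a z} (fun z => 1 - R.s (R.inv z))) +
      D.ωminus a * (1 - infProd {z | R.same a z ∧ D.lt z a} (fun z => 1 - R.s (R.inv z))) ∧
    0 ≤ D.ωplus a ∧ 0 ≤ D.ωminus a ∧ D.ωplus a + D.ωminus a ≤ 1 := by
  classical
  have hsymm : ∀ x y, R.same x y → R.same y x := fun x y h => Relation.EqvGen.symm _ _ h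
  have htrans : ∀ x y z, R.same x y → R.same y z → R.same x z :=
    fun x y z h h' => Relation.EqvGen.trans _ _ _ h h'
  have hf : ∀ z, 0 ≤ (fun z => 1 - R.s (R.inv z)) z := fun z => by
    have := R.s_le_one (R.inv z)
    simp only; linarith
  have bp : BddAbove {x | ∃ b, R.same a b ∧ D.lt a b ∧ x = R.ω a (R.inv b)} :=
    ⟨1, by rintro _ ⟨b, _, _, rfl⟩; exact R.ω_le_one _ _⟩
  have bm : BddAbove {x | ∃ b, R.same a b ∧ D.lt b a ∧ x = R.ω a (R.inv b)} :=
    ⟨1, by rintro _ ⟨b, _, _, rfl⟩; exact R.ω_le_one _ _⟩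
  have lep : ∀ b, R.same a b → D.lt a b → R.ω a (R.inv b) ≤ D.ωplus a :=
    fun b h h' => le_csSup bp ⟨b, h, h', rfl⟩
  have lem : ∀ b, R.same a b → D.lt b a → R.ω a (R.inv b) ≤ D.ωminus a :=
    fun b h h' => le_csSup bm ⟨b, h, h', rfl⟩
  have p0 : 0 ≤ D.ωplus a :=
    Real.sSup_nonneg (by rintro _ ⟨b, _, _, rfl⟩; exact R.ω_nonneg _ _)
  have m0 : 0 ≤ D.ωminus a :=
    Real.sSup_nonneg (by rintro _ ⟨b, _, _, rfl⟩; exact R.ω_nonneg _ _)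
  have m1 : D.ωminus a ≤ 1 :=
    Real.sSup_le (by rintro _ ⟨b, _, _, rfl⟩; exact R.ω_le_one _ _) zero_le_one
  refine ⟨?_, p0, m0, ?_⟩
  · let e : S ≃ S := ⟨R.inv, R.inv, R.inv_inv, R.inv_inv⟩
    have hs : HasSum (fun b => R.p a (R.inv b)) 1 := (e.hasSum_iff (f := R.p a)).2 (R.p_rowSum a)
    refine hasSum_le_of_sum_le hs fun G => ?_
    set Ap : Set S := {z | R.same a z ∧ D.lt a z} with hAp
    set Am : Set S := {z | R.same a z ∧ D.lt z a} with hAm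
    have hsplit : ∑ b ∈ G, R.p a (R.inv b) =
        ∑ b ∈ G.filter (· ∈ Ap), R.ω a (R.inv b) * R.s (R.inv b) +
        ∑ b ∈ G.filter (· ∈ Am), R.ω a (R.inv b) * R.s (R.inv b) := by
      rw [Finset.sum_filter, Finset.sum_filter, ← Finset.sum_add_distrib]
      refine Finset.sum_congr rfl fun b _ => ?_
      rw [← R.p_eq]
      by_cases h1 : D.lt a b
      · have h2 : ¬ D.lt b a := fun h => D.irrefl _ (D.trans _ _ _ h1 h)
        by_cases h3 : R.same a b
        · simp [hAp, hAm, h1, h2, h3]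
        · have : R.ω a (R.inv b) = 0 := by
            by_contra hne
            exact h3 (Relation.EqvGen.rel _ _
              (Or.inl (lt_of_le_of_ne (R.ω_nonneg _ _) (Ne.symm hne))))
          simp [R.p_eq, this]
      · by_cases h3 : R.same a b
        · rcases D.total a b h3 with h | h | h
          · subst h; simp [R.p_inv]
          · exact absurd h h1
          · simp [hAp, hAm, h1, h, h3]
        · have : R.ω a (R.inv b) = 0 := by
            by_contra hne
            exact h3 (Relation.EqvGen.rel _ _
              (Or.inl (lt_of_le_of_ne (R.ω_nonneg _ _) (Ne.symm hne))))
          simp [R.p_eq, this]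
    rw [hsplit]
    have sp : ↑(G.filter (· ∈ Ap)) ⊆ Ap := fun x hx => (Finset.mem_filter.1 hx).2
    have sm : ↑(G.filter (· ∈ Am)) ⊆ Am := fun x hx => (Finset.mem_filter.1 hx).2
    have h1 := sum_bound D.lt Ap (fun b => R.ω a (R.inv b)) (fun b => R.s (R.inv b))
      D.trans (fun x hx y hy => D.total x y (htrans _ _ _ (hsymm _ _ hx.1) hy.1))
      (fun x => (R.s_pos _).le) (fun x => R.s_le_one _)
      (fun b hb c hc h => D.compat_mono a b c hb.1 (htrans _ _ _ (hsymm _ _ hb.1) hc.1)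
        (Or.inl ⟨hb.2, h⟩)) _ _ (D.ωplus a) rfl sp (fun x hx => lep x (sp hx).1 (sp hx).2)
    have h2 := sum_bound (fun x y => D.lt y x) Am (fun b => R.ω a (R.inv b))
      (fun b => R.s (R.inv b))
      (fun x y z h h' => D.trans _ _ _ h' h)
      (fun x hx y hy => by
        have := D.total x y (htrans _ _ _ (hsymm _ _ hx.1) hy.1)
        tauto)
      (fun x => (R.s_pos _).le) (fun x => R.s_le_one _)
      (fun b hb c hc h => D.compat_mono a b c hb.1 (htrans _ _ _ (hsymm _ _ hb.1) hc.1)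
        (Or.inr ⟨h, hb.2⟩)) _ _ (D.ωminus a) rfl sm (fun x hx => lem x (sm hx).1 (sm hx).2)
    have h3 := infProd_le Ap (fun z => 1 - R.s (R.inv z)) hf _ sp
    have h4 := infProd_le Am (fun z => 1 - R.s (R.inv z)) hf _ sm
    refine add_le_add (h1.trans ?_) (h2.trans ?_)
    · exact mul_le_mul_of_nonneg_left (by linarith) p0
    · exact mul_le_mul_of_nonneg_left (by linarith) m0
  · rw [← le_sub_iff_add_le]
    refine Real.sSup_le ?_ (by linarith)
    rintro _ ⟨c, hc, hac, rfl⟩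
    rw [le_sub_comm]
    refine Real.sSup_le ?_ (by linarith [R.ω_le_one a (R.inv c)])
    rintro _ ⟨b, hb, hba, rfl⟩
    linarith [D.compat_sum b a c (hsymm _ _ hb) hc hba hac]

/-- Corollary `cor:final-divergence`: eventual scattering occurs with
probability one in any direction of positive transmission. -/
theorem stmt2 {S : Type*} [Countable S] (R : Scatter.Rep S) (D : Scatter.Delineation R)
    (a : S) :
    (0 < D.ωplus a →
      Scatter.infProd {z | R.same a z ∧ D.lt a z} (fun z => 1 - R.s (R.inv z)) = 0) ∧
    (0 < D.ωminus a →
      Scatter.infProd {z | R.same a z ∧ D.lt z a} (fun z => 1 - R.s (R.inv z)) = 0) := by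
  have hf : ∀ z, 0 ≤ (fun z => 1 - R.s (R.inv z)) z := fun z => by
    have := R.s_le_one (R.inv z)
    simp only; linarith
  obtain ⟨h, p0, m0, h1⟩ := stmt2_key R D a
  have hp := Scatter.infProd_nonneg {z | R.same a z ∧ D.lt a z} _ hf
  have hm := Scatter.infProd_nonneg {z | R.same a z ∧ D.lt z a} _ hf
  have h2 := mul_nonneg p0 hp
  have h3 := mul_nonneg m0 hm
  constructor
  · intro hpos
    refine le_antisymm ?_ hp
    refine le_of_mul_le_mul_left ?_ hpos
    linarith
  · intro hpos
    refine le_antisymm ?_ hm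
    refine le_of_mul_le_mul_left ?_ hpos
    linarith
end

section
/- For a delineated abstract scattering representation of a non-lazy Markov transition matrix, scattering probabilities are locally summable within each scattering class: if a ≺ b both lie in the scattering class E, then the family (s c̃) indexed by {c ∈ E : a ⪯ c ⪯ b} is summable. -/
open scoped BigOperators

namespace Scatter

/-- The closed interval between `x` and `y` within a scattering class. -/
def betw {S : Type*} (R : Rep S) (D : Delineation R) (x y : S) : Set S :=
  {c | R.same x c ∧ (((D.lt x c ∨ x = c) ∧ (D.lt c y ∨ c = y)) ∨
    ((D.lt y c ∨ y = c) ∧ (D.lt c x ∨ c = x)))}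

lemma edge_summable {S : Type*} (R : Rep S) (D : Delineation R) (x y : S)
    (h : 0 < R.ω x (R.inv y)) :
    Summable ((betw R D x y).indicator fun c => R.s (R.inv c)) := by
  classical
  have hinj : Function.Injective R.inv := fun u v huv => by
    rw [← R.inv_inv u, huv, R.inv_inv]
  have h1 : Summable fun c => (R.ω x (R.inv y))⁻¹ * R.p x (R.inv c) :=
    ((R.p_rowSum x).summable.comp_injective hinj).mul_left _
  have h2 : Summable ((({x, y} : Finset S) : Set S).indicator fun c => R.s (R.inv c)) := by
    apply summable_of_finite_support
    exact (Finset.finite_toSet ({x, y} : Finset S)).subset Set.support_indicator_subset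
  have h1n : ∀ c, 0 ≤ (R.ω x (R.inv y))⁻¹ * R.p x (R.inv c) := fun c =>
    mul_nonneg (inv_nonneg.2 h.le) (R.p_nonneg _ _)
  have h2n : ∀ c, 0 ≤ (({x, y} : Finset S) : Set S).indicator (fun c => R.s (R.inv c)) c :=
    fun c => Set.indicator_nonneg (fun c _ => (R.s_pos _).le) c
  have hxy : R.same x y := Relation.EqvGen.rel _ _ (Or.inl h)
  refine Summable.of_nonneg_of_le
    (fun c => Set.indicator_nonneg (fun c _ => (R.s_pos _).le) c) (fun c => ?_) (h1.add h2)
  by_cases hc : c ∈ betw R D x y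
  · rw [Set.indicator_of_mem hc]
    by_cases hm : c ∈ (({x, y} : Finset S) : Set S)
    · have := h1n c
      rw [Set.indicator_of_mem hm]
      linarith
    · have h2c := h2n c
      have hne : c ≠ x ∧ c ≠ y := by simpa using hm
      have hst : (D.lt x c ∧ D.lt c y) ∨ (D.lt y c ∧ D.lt c x) := by
        rcases hc.2 with ⟨h3 | h3, h4 | h4⟩ | ⟨h3 | h3, h4 | h4⟩ <;>
          first
          | exact Or.inl ⟨h3, h4⟩
          | exact Or.inr ⟨h3, h4⟩
          | exact absurd h4 hne.1
          | exact absurd h4 hne.2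
          | exact absurd h3.symm hne.1
          | exact absurd h3.symm hne.2
      have hm := D.compat_mono x c y hc.1 ((hc.1.symm _ _).trans _ _ _ hxy) hst
      have hle : R.ω x (R.inv y) ≤ R.ω x (R.inv c) := by
        nlinarith [mul_nonneg (R.ω_nonneg x (R.inv c)) (R.s_pos (R.inv c)).le]
      have : R.s (R.inv c) ≤ (R.ω x (R.inv y))⁻¹ * R.p x (R.inv c) := by
        rw [inv_mul_eq_div, le_div_iff₀ h, R.p_eq, mul_comm]
        exact mul_le_mul_of_nonneg_right hle (R.s_pos _).le
      linarith
  · rw [Set.indicator_of_notMem hc]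
    exact add_nonneg (h1n c) (h2n c)

lemma betw_symm {S : Type*} (R : Rep S) (D : Delineation R) (x y : S) (h : R.same x y) :
    betw R D x y = betw R D y x := by
  ext c
  constructor
  · rintro ⟨h1, h2⟩
    exact ⟨(h.symm _ _).trans _ _ _ h1, h2.symm⟩
  · rintro ⟨h1, h2⟩
    exact ⟨h.trans _ _ _ h1, h2.symm⟩

lemma betw_summable {S : Type*} (R : Rep S) (D : Delineation R) (x y : S) (h : R.same x y) :
    Summable ((betw R D x y).indicator fun c => R.s (R.inv c)) := by
  induction h with
  | rel x y h =>
    rcases h with h | h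
    · exact edge_summable R D x y h
    · rw [betw_symm R D x y (Relation.EqvGen.rel _ _ (Or.inr h))]
      exact edge_summable R D y x h
  | refl x =>
    apply summable_of_finite_support
    refine (Set.finite_singleton x).subset (Set.support_indicator_subset.trans ?_)
    rintro c ⟨-, ⟨h1 | h1, h2 | h2⟩ | ⟨h1 | h1, h2 | h2⟩⟩ <;>
      first
      | exact h2
      | exact h1.symm
      | exact absurd (D.trans _ _ _ h1 h2) (D.irrefl _)
  | symm x y h ih =>
    rw [← betw_symm R D x y h]
    exact ih
  | trans x y z hxy hyz ih1 ih2 =>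
    have hn : ∀ (A : Set S) c, 0 ≤ A.indicator (fun c => R.s (R.inv c)) c :=
      fun A c => Set.indicator_nonneg (fun c _ => (R.s_pos _).le) c
    refine Summable.of_nonneg_of_le (hn _) (fun c => ?_) (ih1.add ih2)
    have e1 := hn (betw R D x y) c
    have e2 := hn (betw R D y z) c
    by_cases hc : c ∈ betw R D x z
    · have hyc : R.same y c := (hxy.symm _ _).trans _ _ _ hc.1
      have hor : c ∈ betw R D x y ∨ c ∈ betw R D y z := by
        have ht : (D.lt c y ∨ c = y) ∨ (D.lt y c ∨ y = c) := by
          rcases D.total y c hyc with h | h | h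
          · exact Or.inr (Or.inr h)
          · exact Or.inr (Or.inl h)
          · exact Or.inl (Or.inl h)
        rcases hc.2 with ⟨h1, h2⟩ | ⟨h1, h2⟩
        · rcases ht with h3 | h3
          · exact Or.inl ⟨hc.1, Or.inl ⟨h1, h3⟩⟩
          · exact Or.inr ⟨hyc, Or.inl ⟨h3, h2⟩⟩
        · rcases ht with h3 | h3
          · exact Or.inr ⟨hyc, Or.inr ⟨h1, h3⟩⟩
          · exact Or.inl ⟨hc.1, Or.inr ⟨h3, h2⟩⟩
      rw [Set.indicator_of_mem hc]
      rcases hor with hm | hm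
      · rw [Set.indicator_of_mem hm] at e1 ⊢
        linarith
      · rw [Set.indicator_of_mem hm (f := fun c => R.s (R.inv c))] at e2 ⊢
        linarith
    · rw [Set.indicator_of_notMem hc]
      exact add_nonneg e1 e2

end Scatter

/-- Corollary `cor:local-summability`: scattering probabilities are
locally summable within each scattering class: if `a ≺ b` lie in the same scattering
class then the family `(s c̃)` over `{c ∈ E : a ⪯ c ⪯ b}` is summable. -/
theorem stmt3 {S : Type*} [Countable S] (R : Scatter.Rep S) (D : Scatter.Delineation R)
    (a b : S) (hab : R.same a b) (hlt : D.lt a b) :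
    Summable (fun c : {c : S // R.same a c ∧ (D.lt a c ∨ a = c) ∧ (D.lt c b ∨ c = b)} =>
      R.s (R.inv c.1)) := by
  have h := Scatter.betw_summable R D a b hab
  rw [← summable_subtype_iff_indicator] at h
  exact h.comp_injective
    (i := fun c : {c : S // R.same a c ∧ (D.lt a c ∨ a = c) ∧ (D.lt c b ∨ c = b)} =>
      (⟨c.1, c.2.1, Or.inl c.2.2⟩ : Scatter.betw R D a b))
    (fun u v huv => Subtype.ext (congrArg (fun w => w.1) huv))
end

section
/- Let I be a countable linearly ordered set and s : I → [0,1] a function such that for every z ∈ I the family (s_c) indexed by {c ∈ I : c < z} is summable. Then ∑_{z ∈ I} (∏_{c ∈ I, c < z} (1 − s_c)) · s_z = 1 − ∏_{c ∈ I} (1 − s_c). Moreover the right-hand side equals 1 if and only if either the family (s_c)_{c ∈ I} is not summable or s_c = 1 for some c ∈ I. -/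
open scoped BigOperators

/-- Infinite product over a subset, interpreted as the infimum of finite subproducts. -/
noncomputable def infProd {I : Type*} (A : Set I) (f : I → ℝ) : ℝ :=
  ⨅ F : {F : Finset I // ↑F ⊆ A}, ∏ z ∈ F.1, f z

lemma prod_anti_aux {I : Type*} {f : I → ℝ} {F G : Finset I} (h : F ⊆ G)
    (h0 : ∀ c ∈ G, 0 ≤ f c) (h1 : ∀ c ∈ G, c ∉ F → f c ≤ 1) :
    ∏ c ∈ G, f c ≤ ∏ c ∈ F, f c := by
  classical
  rw [← Finset.prod_sdiff h]
  refine mul_le_of_le_one_left (Finset.prod_nonneg fun c hc => h0 c (h hc)) ?_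
  exact Finset.prod_le_one (fun c hc => h0 c (Finset.mem_sdiff.1 hc).1)
    fun c hc => h1 c (Finset.mem_sdiff.1 hc).1 (Finset.mem_sdiff.1 hc).2

lemma infProd_le_aux {I : Type*} (s : I → ℝ) (h1 : ∀ c, s c ≤ 1) (A : Set I) (F : Finset I)
    (hF : ↑F ⊆ A) : infProd A (fun c => 1 - s c) ≤ ∏ z ∈ F, (1 - s z) := by
  refine ciInf_le (f := fun F : {F : Finset I // ↑F ⊆ A} => ∏ z ∈ F.1, (1 - s z)) ?_ ⟨F, hF⟩
  refine ⟨0, ?_⟩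
  rintro _ ⟨G, rfl⟩
  exact Finset.prod_nonneg fun c _ => sub_nonneg.2 (h1 c)

lemma le_infProd_aux {I : Type*} (f : I → ℝ) (A : Set I) (b : ℝ)
    (h : ∀ F : Finset I, ↑F ⊆ A → b ≤ ∏ z ∈ F, f z) : b ≤ infProd A f := by
  have : Nonempty {F : Finset I // ↑F ⊆ A} := ⟨⟨∅, by simp⟩⟩
  exact le_ciInf fun F => h F.1 F.2

lemma one_sub_sum_aux {I : Type*} (s : I → ℝ) (h0 : ∀ c, 0 ≤ s c) (h1 : ∀ c, s c ≤ 1)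
    (H : Finset I) : 1 - ∑ c ∈ H, s c ≤ ∏ c ∈ H, (1 - s c) := by
  classical
  induction H using Finset.induction_on with
  | empty => simp
  | insert a H ha ih =>
    rw [Finset.sum_insert ha, Finset.prod_insert ha]
    have := mul_le_mul_of_nonneg_left ih (sub_nonneg.2 (h1 a))
    have h2 := mul_nonneg (h0 a) (Finset.sum_nonneg fun c (_ : c ∈ H) => h0 c)
    nlinarith

lemma low_aux {I : Type*} (s : I → ℝ) (h0 : ∀ c, 0 ≤ s c) (h1 : ∀ c, s c ≤ 1)
    (A : Set I) (G : Finset I) (ε : ℝ)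
    (hε : ∀ H : Finset I, ↑H ⊆ A → Disjoint H G → ∑ c ∈ H, s c ≤ ε) :
    (∏ c ∈ G, (1 - s c)) * (1 - ε) ≤ infProd A (fun c => 1 - s c) := by
  classical
  refine le_infProd_aux _ _ _ fun F hF => ?_
  have hn : ∀ c, 0 ≤ 1 - s c := fun c => sub_nonneg.2 (h1 c)
  have e1 : 1 - ε ≤ ∏ c ∈ F \ G, (1 - s c) := by
    have := hε (F \ G) (fun x hx => hF (Finset.mem_sdiff.1 hx).1) Finset.sdiff_disjoint
    linarith [one_sub_sum_aux s h0 h1 (F \ G)]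
  calc (∏ c ∈ G, (1 - s c)) * (1 - ε) 
      ≤ (∏ c ∈ G, (1 - s c)) * ∏ c ∈ F \ G, (1 - s c) :=
        mul_le_mul_of_nonneg_left e1 (Finset.prod_nonneg fun c _ => hn c)
    _ = ∏ c ∈ G ∪ F, (1 - s c) := by
        rw [← Finset.prod_union Finset.disjoint_sdiff, Finset.union_sdiff_self_eq_union]
    _ ≤ ∏ c ∈ F, (1 - s c) :=
        prod_anti_aux Finset.subset_union_right (fun c _ => hn c)
          (fun c _ _ => by linarith [h0 c])

lemma tail_aux {I : Type*} (s : I → ℝ) (h : Summable s) (ε : ℝ) (hε : 0 < ε) :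
    ∃ G : Finset I, ∀ H : Finset I, Disjoint H G → ∑ c ∈ H, s c ≤ ε := by
  obtain ⟨G, hG⟩ := summable_iff_vanishing_norm.1 h ε hε
  exact ⟨G, fun H hH => (le_abs_self _).trans (hG H hH).le⟩

theorem stmt5 {I : Type*} [Countable I] [LinearOrder I] (s : I → ℝ)
    (h0 : ∀ c, 0 ≤ s c) (h1 : ∀ c, s c ≤ 1)
    (hloc : ∀ z : I, Summable fun c : {c : I // c < z} => s c.1) :
    HasSum (fun z : I => infProd {c | c < z} (fun c => 1 - s c) * s z)
      (1 - infProd Set.univ (fun c => 1 - s c)) ∧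
    (1 - infProd Set.univ (fun c => 1 - s c) = 1 ↔
      (¬ Summable s ∨ ∃ c, s c = 1)) := by
  classical
  have hn : ∀ c, 0 ≤ 1 - s c := fun c => sub_nonneg.2 (h1 c)
  have hP : ∀ A : Set I, 0 ≤ infProd A (fun c => 1 - s c) := fun A =>
    le_infProd_aux _ _ _ fun F _ => Finset.prod_nonneg fun c _ => hn c
  have hid : ∀ F : Finset I, ∏ c ∈ F, (1 - s c)
      = 1 - ∑ z ∈ F, s z * ∏ c ∈ F with c < z, (1 - s c) := fun F =>
    Finset.prod_one_sub_ordered F s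
  constructor
  · refine hasSum_of_isLUB_of_nonneg _ (fun z => mul_nonneg (hP _) (h0 z)) ⟨?_, ?_⟩
    · rintro _ ⟨F, rfl⟩
      have e1 := infProd_le_aux s h1 Set.univ F (Set.subset_univ _)
      have e2 : ∑ z ∈ F, infProd {c | c < z} (fun c => 1 - s c) * s z
          ≤ ∑ z ∈ F, s z * ∏ c ∈ F with c < z, (1 - s c) := by
        refine Finset.sum_le_sum fun z _ => ?_
        rw [mul_comm]
        refine mul_le_mul_of_nonneg_left (infProd_le_aux s h1 _ _ ?_) (h0 z)
        intro c hc
        exact (Finset.mem_filter.1 hc).2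
      have := hid F
      show ∑ z ∈ F, infProd {c | c < z} (fun c => 1 - s c) * s z ≤ _
      linarith
    · intro b hb
      have hb' : ∀ F : Finset I, ∑ z ∈ F, infProd {c | c < z} (fun c => 1 - s c) * s z ≤ b :=
        fun F => hb ⟨F, rfl⟩
      have hb0 : 0 ≤ b := by simpa using hb' ∅
      suffices h : 1 - b ≤ infProd Set.univ (fun c => 1 - s c) by linarith
      refine le_infProd_aux _ _ _ fun F _ => ?_
      rcases F.eq_empty_or_nonempty with rfl | hF
      · simpa using hb0
      refine le_of_forall_pos_le_add fun ε hε => ?_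
      set z0 := F.max' hF with hz0
      have hs : Summable (Set.indicator (Set.Iic z0) s) := by
        have a1 : Summable (Set.indicator (Set.Iio z0) s) :=
          summable_subtype_iff_indicator.1 (hloc z0)
        have a2 : Summable (Set.indicator {z0} s) :=
          summable_of_ne_finset_zero (s := {z0}) (by intro c hc; simp_all)
        refine (a1.add a2).congr fun c => ?_
        rcases lt_trichotomy c z0 with h | h | h
        · simp [Set.indicator, h, h.le, h.ne]
        · simp [Set.indicator, h]
        · simp [Set.indicator, h.not_ge, h.not_gt, h.ne']
      obtain ⟨G, hG⟩ := tail_aux _ hs ε hε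
      set K := F ∪ G with hK
      have e1 : ∏ c ∈ K, (1 - s c) ≤ ∏ c ∈ F, (1 - s c) :=
        prod_anti_aux Finset.subset_union_left (fun c _ => hn c)
          (fun c _ _ => by linarith [h0 c])
      have hK' : ∀ z, z ≤ z0 → (∏ c ∈ K with c < z, (1 - s c)) * (1 - ε) ≤
          infProd {c | c < z} (fun c => 1 - s c) := by
        intro z hz
        refine low_aux s h0 h1 _ _ _ fun H hH hd => ?_
        have : ∑ c ∈ H, s c = ∑ c ∈ H, Set.indicator (Set.Iic z0) s c := by
          refine Finset.sum_congr rfl fun c hc => ?_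
          have : c < z := hH hc
          rw [Set.indicator_of_mem]
          exact (this.trans_le hz).le
        rw [this]
        refine hG H ?_
        rw [Finset.disjoint_left] at hd ⊢
        intro c hc hcG
        exact hd hc (Finset.mem_filter.2 ⟨Finset.mem_union_right _ hcG, hH hc⟩)
      set L := K.filter (· ≤ z0) with hL
      have hLz : ∀ z ∈ L, (L.filter (· < z)) = K.filter (· < z) := by
        intro z hz
        have := (Finset.mem_filter.1 hz).2
        ext c
        simp only [hL, Finset.mem_filter]
        constructor
        · tauto
        · rintro ⟨a, b⟩
          exact ⟨⟨a, (b.trans_le this).le⟩, b⟩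
      have hFL : F ⊆ L := fun c hc =>
        Finset.mem_filter.2 ⟨Finset.mem_union_left _ hc, F.le_max' c hc⟩
      have e2 : ∏ c ∈ L, (1 - s c) ≤ ∏ c ∈ F, (1 - s c) :=
        prod_anti_aux hFL (fun c _ => hn c)
          (fun c _ _ => by linarith [h0 c])
      have e3 : (∑ z ∈ L, s z * ∏ c ∈ L with c < z, (1 - s c)) * (1 - ε) ≤ b := by
        refine le_trans ?_ (hb' L)
        rw [Finset.sum_mul]
        refine Finset.sum_le_sum fun z hz => ?_
        rw [hLz z hz, mul_assoc, mul_comm]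
        exact mul_le_mul_of_nonneg_right (hK' z (Finset.mem_filter.1 hz).2) (h0 z)
      have e4 := hid L
      have e5 : 0 ≤ ∏ c ∈ L, (1 - s c) := Finset.prod_nonneg fun c _ => hn c
      have e6 : (∑ z ∈ L, s z * ∏ c ∈ L with c < z, (1 - s c)) = 1 - ∏ c ∈ L, (1 - s c) := by
        linarith
      rw [e6] at e3
      nlinarith [mul_nonneg hε.le e5]
  · constructor
    · intro h
      have hz : infProd Set.univ (fun c => 1 - s c) = 0 := by linarith
      by_contra hcon
      push Not at hcon
      obtain ⟨hs, hne⟩ := hcon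
      obtain ⟨G, hG⟩ := tail_aux s hs (1/2) (by norm_num)
      have := low_aux s h0 h1 Set.univ G (1/2) (fun H _ hd => hG H hd)
      have hp : 0 < ∏ c ∈ G, (1 - s c) :=
        Finset.prod_pos fun c _ => sub_pos.2 (lt_of_le_of_ne (h1 c) (hne c))
      rw [hz] at this
      linarith
    · intro h
      suffices hz : infProd Set.univ (fun c => 1 - s c) = 0 by linarith
      rcases h with h | ⟨c, hc⟩
      · by_contra hne
        have hpos : 0 < infProd Set.univ (fun c => 1 - s c) := lt_of_le_of_ne (hP _) (Ne.symm hne)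
        refine h (summable_of_sum_le (c := -Real.log (infProd Set.univ (fun c => 1 - s c))) h0 ?_)
        intro F
        have e1 := infProd_le_aux s h1 Set.univ F (Set.subset_univ _)
        have e2 : ∏ c ∈ F, (1 - s c) ≤ Real.exp (-∑ c ∈ F, s c) := by
          rw [← Finset.sum_neg_distrib, Real.exp_sum]
          exact Finset.prod_le_prod (fun c _ => hn c) fun c _ => Real.one_sub_le_exp_neg (s c)
        have e3 := Real.log_le_log hpos (e1.trans e2)
        rw [Real.log_exp] at e3
        linarith
      · refine le_antisymm ?_ (hP _)
        have := infProd_le_aux s h1 Set.univ {c} (Set.subset_univ _)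
        simpa [hc] using this
end

section
/- For a delineated abstract scattering representation of a non-lazy Markov transition matrix which satisfies dynamical detailed balance with some invariant measure π (not necessarily unbiased or balanced): if a, b, c all lie in one scattering class E with a ≺ b ≺ c, and ω a c̃ > 0, then ω_{b,+} = ω_{b,−} = 1/2. -/
open scoped BigOperators

namespace Scatter

variable {S : Type*}

lemma exists_top (lt : S → S → Prop) (irrefl : ∀ a, ¬ lt a a)
    (trans : ∀ a b c, lt a b → lt b c → lt a c) (H : Finset S) (hH : H.Nonempty)
    (tot : ∀ x ∈ H, ∀ y ∈ H, x = y ∨ lt x y ∨ lt y x) :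
    ∃ m ∈ H, ∀ y ∈ H, y ≠ m → lt y m := by
  classical
  induction hH using Finset.Nonempty.cons_induction with
  | singleton a => exact ⟨a, by simp, by simp⟩
  | cons a s ha hs ih =>
    obtain ⟨m, hm, hmax⟩ := ih (fun x hx y hy => tot x (by simp [hx]) y (by simp [hy]))
    rcases tot a (by simp) m (by simp [hm]) with h | h | h
    · exact absurd (h ▸ hm) ha
    · refine ⟨m, by simp [hm], ?_⟩
      intro y hy hne
      rcases Finset.mem_cons.1 hy with rfl | hy
      · exact h
      · exact hmax y hy hne
    · refine ⟨a, by simp, ?_⟩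
      intro y hy hne
      rcases Finset.mem_cons.1 hy with rfl | hy
      · exact absurd rfl hne
      · by_cases hym : y = m
        · exact hym ▸ h
        · exact trans _ _ _ (hmax y hy hym) h

lemma chain (lt : S → S → Prop) (irrefl : ∀ a, ¬ lt a a)
    (trans : ∀ a b c, lt a b → lt b c → lt a c) (f t : S → ℝ) (M : ℝ) (hM0 : 0 ≤ M)
    (ht0 : ∀ z, 0 ≤ t z) (ht1 : ∀ z, t z ≤ 1) (n : ℕ) :
    ∀ (H : Finset S), H.card = n →
    (∀ x ∈ H, ∀ y ∈ H, x = y ∨ lt x y ∨ lt y x) →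
    (∀ x ∈ H, f x ≤ M) → (∀ x ∈ H, ∀ y ∈ H, lt y x → f x ≤ f y * (1 - t y)) →
    (∑ z ∈ H, f z * t z ≤ M * (1 - ∏ z ∈ H, (1 - t z))) ∧
    (∀ x, f x ≤ M → (∀ y ∈ H, f x ≤ f y * (1 - t y)) → f x ≤ M * ∏ z ∈ H, (1 - t z)) := by
  classical
  induction n with
  | zero =>
    intro H hH _ _ _
    rw [Finset.card_eq_zero] at hH
    subst hH
    simp
  | succ n ih =>
    intro H hH tot hM mono
    obtain ⟨m, hm, hmax⟩ := exists_top lt irrefl trans H (Finset.card_pos.1 (by omega)) tot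
    obtain ⟨i1, i2⟩ := ih (H.erase m) (by rw [Finset.card_erase_of_mem hm]; omega)
      (fun x hx y hy => tot x (Finset.mem_of_mem_erase hx) y (Finset.mem_of_mem_erase hy))
      (fun x hx => hM x (Finset.mem_of_mem_erase hx))
      (fun x hx y hy => mono x (Finset.mem_of_mem_erase hx) y (Finset.mem_of_mem_erase hy))
    have hfm := i2 m (hM m hm) (fun y hy => mono m hm y (Finset.mem_of_mem_erase hy)
      (hmax y (Finset.mem_of_mem_erase hy) (Finset.ne_of_mem_erase hy)))
    rw [← Finset.add_sum_erase H _ hm, ← Finset.mul_prod_erase H _ hm]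
    set P := ∏ z ∈ H.erase m, (1 - t z)
    constructor
    · have := mul_le_mul_of_nonneg_right hfm (ht0 m)
      nlinarith
    · intro x hx hy
      have h1 := hy m hm
      have := mul_le_mul_of_nonneg_right hfm (sub_nonneg.2 (ht1 m))
      nlinarith

lemma Rep.same_symm (R : Rep S) {a b : S} (h : R.same a b) : R.same b a :=
  Relation.EqvGen.symm _ _ h

lemma Rep.same_trans (R : Rep S) {a b c : S} (h : R.same a b) (h' : R.same b c) : R.same a c :=
  Relation.EqvGen.trans _ _ _ h h'

/-- The reversed delineation. -/
def Delineation.dual {R : Rep S} (D : Delineation R) : Delineation R where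
  lt := fun a b => D.lt b a
  irrefl := D.irrefl
  trans := fun a b c h h' => D.trans _ _ _ h' h
  total := fun a b h => by
    rcases D.total a b h with h | h | h
    · exact Or.inl h
    · exact Or.inr (Or.inr h)
    · exact Or.inr (Or.inl h)
  compat_sum := fun a b c h h' l l' => by
    have := D.compat_sum c b a (R.same_symm h') (R.same_symm h) l' l
    linarith
  compat_mono := fun a b c h h' l => D.compat_mono a b c h h' (by tauto)

section
variable {R : Rep S} (D : Delineation R)

lemma Delineation.le_ωplus {a b : S} (h : R.same a b) (l : D.lt a b) :
    R.ω a (R.inv b) ≤ D.ωplus a := by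
  apply le_csSup
  · exact ⟨1, by rintro x ⟨b, _, _, rfl⟩; exact R.ω_le_one _ _⟩
  · exact ⟨b, h, l, rfl⟩

lemma Delineation.ωplus_nonneg (a : S) : 0 ≤ D.ωplus a := by
  apply Real.sSup_nonneg
  rintro x ⟨b, _, _, rfl⟩; exact R.ω_nonneg _ _

lemma Delineation.ωplus_add_ωminus_le (a : S) : D.ωplus a + D.ωminus a ≤ 1 := by
  have h1 : ∀ b, R.same a b → D.lt a b → D.ωminus a ≤ 1 - R.ω a (R.inv b) := by
    intro b hb l
    apply Real.sSup_le
    · rintro x ⟨c, hc, l', rfl⟩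
      have := D.compat_sum c a b (R.same_symm hc) hb l' l
      linarith
    · linarith [R.ω_le_one a (R.inv b)]
  have h0 : D.ωminus a ≤ 1 := by
    apply Real.sSup_le
    · rintro x ⟨c, hc, l', rfl⟩
      exact R.ω_le_one _ _
    · norm_num
  have h2 : D.ωplus a ≤ 1 - D.ωminus a := by
    apply Real.sSup_le
    · rintro x ⟨c, hc, l', rfl⟩
      linarith [h1 c hc l']
    · linarith
  linarith

lemma Delineation.sum_plus_le (a : S) (H : Finset S) (hs : ∀ z ∈ H, R.same a z)
    (hl : ∀ z ∈ H, D.lt a z) (M : ℝ) (hM0 : 0 ≤ M) (hM : ∀ z ∈ H, R.ω a (R.inv z) ≤ M) :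
    (∑ z ∈ H, R.p a (R.inv z) ≤ M * (1 - ∏ z ∈ H, (1 - R.s (R.inv z)))) ∧
    (∀ x, R.same a x → (∀ y ∈ H, D.lt y x) → R.ω a (R.inv x) ≤ M →
      R.ω a (R.inv x) ≤ M * ∏ z ∈ H, (1 - R.s (R.inv z))) := by
  have key : ∀ y ∈ H, ∀ x, R.same a x → D.lt y x →
      R.ω a (R.inv x) ≤ R.ω a (R.inv y) * (1 - R.s (R.inv y)) := fun y hy x hx l =>
    D.compat_mono a y x (hs y hy) (R.same_trans (R.same_symm (hs y hy)) hx)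
      (Or.inl ⟨hl y hy, l⟩)
  have := chain D.lt D.irrefl D.trans (fun z => R.ω a (R.inv z)) (fun z => R.s (R.inv z)) M hM0
    (fun z => (R.s_pos _).le) (fun z => R.s_le_one _) _ H rfl
    (fun x hx y hy => D.total x y (R.same_trans (R.same_symm (hs x hx)) (hs y hy)))
    hM (fun x hx y hy l => key y hy x (hs x hx) l)
  refine ⟨?_, fun x hx hy hxM => this.2 x hxM (fun y h => key y h x hx (hy y h))⟩
  simpa only [R.p_eq] using this.1

lemma prod01 (H : Finset S) :
    0 ≤ ∏ z ∈ H, (1 - R.s (R.inv z)) :=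
  Finset.prod_nonneg (fun z _ => sub_nonneg.2 (R.s_le_one _))

lemma Delineation.sum_plus_le' (a : S) (H : Finset S) (hs : ∀ z ∈ H, R.same a z)
    (hl : ∀ z ∈ H, D.lt a z) (M : ℝ) (hM0 : 0 ≤ M) (hM : ∀ z ∈ H, R.ω a (R.inv z) ≤ M) :
    ∑ z ∈ H, R.p a (R.inv z) ≤ M := by
  have := (D.sum_plus_le a H hs hl M hM0 hM).1
  nlinarith [mul_nonneg hM0 (prod01 (R := R) H)]

lemma exists_fin (R : Rep S) (a : S) (ε : ℝ) (hε : 0 < ε) :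
    ∃ G : Finset S, (∀ z ∈ G, R.same a z ∧ z ≠ a) ∧ 1 - ε < ∑ z ∈ G, R.p a (R.inv z) := by
  classical
  have h : HasSum (fun z => R.p a (R.inv z)) 1 := by
    let e : S ≃ S := ⟨R.inv, R.inv, R.inv_inv, R.inv_inv⟩
    exact (Equiv.hasSum_iff e).2 (R.p_rowSum a)
  obtain ⟨G, hG⟩ := (h.eventually (lt_mem_nhds (show 1 - ε < 1 by linarith))).exists
  refine ⟨G.filter (fun z => R.same a z ∧ z ≠ a), fun z hz => (Finset.mem_filter.1 hz).2, ?_⟩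
  rw [Finset.sum_filter_of_ne]
  · exact hG
  · intro z _ hz
    refine ⟨Relation.EqvGen.rel _ _ (Or.inl ?_), ?_⟩
    · rcases (R.ω_nonneg a (R.inv z)).lt_or_eq with h | h
      · exact h
      · exact absurd (by rw [R.p_eq, ← h, zero_mul]) hz
    · rintro rfl
      exact hz (R.p_inv _)

lemma Delineation.one_le (a : S) : 1 ≤ D.ωplus a + D.ωminus a := by
  classical
  apply le_of_forall_pos_lt_add
  intro ε hε
  obtain ⟨G, hG, hs⟩ := exists_fin R a ε hε
  rw [← Finset.sum_filter_add_sum_filter_not G (fun z => D.lt a z)] at hs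
  have e1 := D.sum_plus_le' a (G.filter (fun z => D.lt a z))
    (fun z hz => (hG z (Finset.mem_filter.1 hz).1).1) (fun z hz => (Finset.mem_filter.1 hz).2)
    _ (D.ωplus_nonneg a) (fun z hz => D.le_ωplus (hG z (Finset.mem_filter.1 hz).1).1
      (Finset.mem_filter.1 hz).2)
  have hl : ∀ z ∈ G.filter (fun z => ¬ D.lt a z), D.lt z a := by
    intro z hz
    obtain ⟨h1, h2⟩ := Finset.mem_filter.1 hz
    rcases D.total a z (hG z h1).1 with h | h | h
    · exact absurd h.symm (hG z h1).2
    · exact absurd h h2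
    · exact h
  have e2 := D.dual.sum_plus_le' a (G.filter (fun z => ¬ D.lt a z))
    (fun z hz => (hG z (Finset.mem_filter.1 hz).1).1) hl
    _ (D.dual.ωplus_nonneg a) (fun z hz => D.dual.le_ωplus (hG z (Finset.mem_filter.1 hz).1).1
      (hl z hz))
  have e3 : D.dual.ωplus a = D.ωminus a := rfl
  linarith

lemma Delineation.approx (a c : S) (hac : R.same a c) (l : D.lt a c) (ε : ℝ) (hε : 0 < ε) :
    ∃ F : Finset S, (∀ z ∈ F, R.same a z ∧ D.lt a z ∧ D.lt z c) ∧
      D.ωplus a * ∏ z ∈ F, (1 - R.s (R.inv z)) ≤ R.ω a (R.inv c) + ε := by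
  classical
  obtain ⟨G, hG, hs⟩ := exists_fin R a ε hε
  rw [← Finset.sum_filter_add_sum_filter_not G (fun z => D.lt a z),
    ← Finset.sum_filter_add_sum_filter_not (G.filter (fun z => D.lt a z)) (fun z => D.lt z c)] at hs
  have hl : ∀ z ∈ G.filter (fun z => ¬ D.lt a z), D.lt z a := by
    intro z hz
    obtain ⟨h1, h2⟩ := Finset.mem_filter.1 hz
    rcases D.total a z (hG z h1).1 with h | h | h
    · exact absurd h.symm (hG z h1).2
    · exact absurd h h2
    · exact h
  have e2 := D.dual.sum_plus_le' a (G.filter (fun z => ¬ D.lt a z))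
    (fun z hz => (hG z (Finset.mem_filter.1 hz).1).1) hl
    _ (D.dual.ωplus_nonneg a) (fun z hz => D.dual.le_ωplus (hG z (Finset.mem_filter.1 hz).1).1
      (hl z hz))
  have e3 : D.dual.ωplus a = D.ωminus a := rfl
  have hF : ∀ z ∈ (G.filter (fun z => D.lt a z)).filter (fun z => D.lt z c),
      R.same a z ∧ D.lt a z ∧ D.lt z c := by
    intro z hz
    simp only [Finset.mem_filter] at hz
    exact ⟨(hG z hz.1.1).1, hz.1.2, hz.2⟩
  refine ⟨_, hF, ?_⟩
  have e1 := (D.sum_plus_le a _ (fun z hz => (hF z hz).1) (fun z hz => (hF z hz).2.1)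
    _ (D.ωplus_nonneg a) (fun z hz => D.le_ωplus (hF z hz).1 (hF z hz).2.1)).1
  have hU : ∀ z ∈ (G.filter (fun z => D.lt a z)).filter (fun z => ¬ D.lt z c),
      R.same a z ∧ D.lt a z ∧ R.ω a (R.inv z) ≤ R.ω a (R.inv c) := by
    intro z hz
    simp only [Finset.mem_filter] at hz
    have hsz := (hG z hz.1.1).1
    refine ⟨hsz, hz.1.2, ?_⟩
    have hcz := R.same_trans (R.same_symm hac) hsz
    rcases D.total c z hcz with h | h | h
    · rw [h]
    · have := D.compat_mono a c z hac hcz (Or.inl ⟨l, h⟩)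
      nlinarith [mul_nonneg (R.ω_nonneg a (R.inv c)) (R.s_pos (R.inv c)).le]
    · exact absurd h hz.2
  have e4 := D.sum_plus_le' a _ (fun z hz => (hU z hz).1) (fun z hz => (hU z hz).2.1)
    _ (R.ω_nonneg a (R.inv c)) (fun z hz => (hU z hz).2.2)
  have e5 := D.ωplus_add_ωminus_le a
  linarith

lemma Delineation.cross_le (a c : S) (hac : R.same a c) (l : D.lt a c) :
    D.ωplus a * R.ω c (R.inv a) ≤ R.ω a (R.inv c) * D.ωminus c := by
  have hm0 : 0 ≤ D.ωminus c := D.dual.ωplus_nonneg c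
  have hm1 : D.ωminus c ≤ 1 := by
    linarith [D.ωplus_add_ωminus_le c, D.ωplus_nonneg c]
  apply le_of_forall_pos_le_add
  intro ε hε
  obtain ⟨F, hF, h⟩ := D.approx a c hac l ε hε
  have hca := R.same_symm hac
  have h2 := (D.dual.sum_plus_le c F (fun z hz => R.same_trans hca (hF z hz).1)
    (fun z hz => (hF z hz).2.2) _ (D.dual.ωplus_nonneg c)
    (fun z hz => D.dual.le_ωplus (R.same_trans hca (hF z hz).1) (hF z hz).2.2)).2 a hca
    (fun z hz => (hF z hz).2.1) (D.dual.le_ωplus hca l)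
  have e3 : D.dual.ωplus c = D.ωminus c := rfl
  rw [e3] at h2
  have h3 := mul_le_mul_of_nonneg_left h2 (D.ωplus_nonneg a)
  have h4 := mul_le_mul_of_nonneg_left h hm0
  nlinarith

lemma Delineation.cross (a c : S) (hac : R.same a c) (l : D.lt a c) :
    R.ω a (R.inv c) * D.ωminus c = D.ωplus a * R.ω c (R.inv a) := by
  have h1 := D.cross_le a c hac l
  have h2 : D.ωminus c * R.ω a (R.inv c) ≤ R.ω c (R.inv a) * D.ωplus a :=
    D.dual.cross_le c a (R.same_symm hac) l
  linarith

lemma db_pos (DB : DetailedBalance R) {a c : S} (h : 0 < R.ω a (R.inv c)) :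
    0 < R.ω c (R.inv a) := by
  have hb := DB.balance a c
  rw [R.p_eq, R.p_eq] at hb
  rcases (R.ω_nonneg c (R.inv a)).lt_or_eq with h' | h'
  · exact h'
  · rw [← h', zero_mul, mul_zero] at hb
    have := mul_pos (DB.π_pos a) (mul_pos h (R.s_pos (R.inv c)))
    linarith

lemma Delineation.db_cross (DB : DetailedBalance R) (a c : S) (hac : R.same a c) (l : D.lt a c)
    (h : 0 < R.ω a (R.inv c)) :
    DB.π a * D.ωplus a * R.s (R.inv c) = DB.π c * D.ωminus c * R.s (R.inv a) := by
  have hb := DB.balance a c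
  rw [R.p_eq, R.p_eq] at hb
  have hx := D.cross a c hac l
  apply mul_right_cancel₀ (db_pos DB h).ne'
  linear_combination D.ωminus c * hb - DB.π a * R.s (R.inv c) * hx

lemma Delineation.mono_pos {a b c : S} (hab : R.same a b) (hbc : R.same b c)
    (l : (D.lt a b ∧ D.lt b c) ∨ (D.lt c b ∧ D.lt b a)) (h : 0 < R.ω a (R.inv c)) :
    0 < R.ω a (R.inv b) := by
  have := D.compat_mono a b c hab hbc l
  exact pos_of_mul_pos_left (lt_of_lt_of_le h this) (sub_nonneg.2 (R.s_le_one _))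

end

end Scatter

theorem stmt6 {S : Type*} [Countable S] (R : Scatter.Rep S) (D : Scatter.Delineation R)
    (DB : Scatter.DetailedBalance R)
    (a b c : S) (hab : R.same a b) (hbc : R.same b c)
    (h1 : D.lt a b) (h2 : D.lt b c) (hpos : 0 < R.ω a (R.inv c)) :
    D.ωplus b = 1 / 2 ∧ D.ωminus b = 1 / 2 := by
  have hac := R.same_trans hab hbc
  have pab := D.mono_pos hab hbc (Or.inl ⟨h1, h2⟩) hpos
  have pcb := D.mono_pos (R.same_symm hbc) (R.same_symm hab) (Or.inr ⟨h1, h2⟩)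
    (Scatter.db_pos DB hpos)
  have pbc := Scatter.db_pos DB pcb
  have E1 := D.db_cross DB a c hac (D.trans _ _ _ h1 h2) hpos
  have E2 := D.db_cross DB a b hab h1 pab
  have E3 := D.db_cross DB b c hbc h2 pbc
  have hne : DB.π b * R.s (R.inv a) * R.s (R.inv c) ≠ 0 :=
    (mul_pos (mul_pos (DB.π_pos b) (R.s_pos _)) (R.s_pos _)).ne'
  have heq : D.ωplus b = D.ωminus b := by
    apply mul_left_cancel₀ hne
    linear_combination R.s (R.inv a) * E3 - R.s (R.inv b) * E1 + R.s (R.inv c) * E2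
  have s1 := D.one_le b
  have s2 := D.ωplus_add_ωminus_le b
  constructor <;> linarith
end

section
/- For an abstract scattering representation of a non-lazy Markov transition matrix satisfying unbiased dynamical detailed balance with invariant measure π: if states a and b lie in the same scattering class, then π a / s ã = π b / s b̃. (Hence π a / s ã is constant on each scattering class.) -/
open scoped BigOperators

/-- Lemma `lem:reverse1`: for an abstract scattering representation
satisfying unbiased dynamical detailed balance, `π a / s ã` is constant on scattering
classes: if `a` and `b` lie in the same scattering class then `π a / s ã = π b / s b̃`. -/
theorem stmt8 {S : Type*} [Countable S] (R : Scatter.Rep S)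
    (DB : Scatter.DetailedBalance R) (hub : R.Unbiased)
    (a b : S) (hab : R.same a b) :
    DB.π a / R.s (R.inv a) = DB.π b / R.s (R.inv b) := by
  have key : ∀ x y, 0 < R.ω x (R.inv y) →
      DB.π x / R.s (R.inv x) = DB.π y / R.s (R.inv y) := by
    intro x y h
    have hb := DB.balance x y
    rw [R.p_eq, R.p_eq, ← hub x y] at hb
    rw [div_eq_div_iff (R.s_pos _).ne' (R.s_pos _).ne']
    apply mul_left_cancel₀ h.ne'
    linarith
  unfold Scatter.Rep.same at hab
  induction hab with
  | rel x y h =>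
    rcases h with h | h
    · exact key x y h
    · exact (key y x h).symm
  | refl x => rfl
  | symm x y _ ih => exact ih.symm
  | trans x y z _ _ h1 h2 => exact h1.trans h2
end

section
/- For a balanced delineated abstract scattering representation of a non-lazy Markov transition matrix satisfying dynamical detailed balance with invariant measure π (such a representation is automatically unbiased, so κ is defined): for every scattering class E and every a ∈ E, κ(E) = 2 · ∑_{c ∈ E, c ≺ a} π c · ω c ã. -/
open scoped BigOperators

namespace ScatterAux

section abstractOrder

variable {E : Type*} [LinearOrder E]

theorem prodBound (w t : E → ℝ) (a : E) (M : ℝ) (ht1 : ∀ b, t b ≤ 1)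
    (hmono : ∀ b c, a < b → b < c → w c ≤ w b * (1 - t b)) (F : Finset E) :
    ∀ m, a < m → (∀ b ∈ F, a < b ∧ b < m ∧ w b ≤ M) → w m ≤ M →
      w m ≤ M * ∏ z ∈ F, (1 - t z) := by
  induction F using Finset.induction_on_max with
  | empty => intro m _ _ h; simpa using h
  | insert x F hx ih =>
    intro m ham hF hm
    have hxF := hF x (Finset.mem_insert_self _ _)
    have h1 := ih x hxF.1 (fun b hb =>
      ⟨(hF b (Finset.mem_insert_of_mem hb)).1, hx b hb,
        (hF b (Finset.mem_insert_of_mem hb)).2.2⟩) hxF.2.2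
    have hnot : x ∉ F := fun h => lt_irrefl _ (hx x h)
    rw [Finset.prod_insert hnot]
    have h2 := hmono x m hxF.1 hxF.2.1
    have h3 := mul_le_mul_of_nonneg_right h1 (sub_nonneg.2 (ht1 x))
    calc w m ≤ _ := h2
      _ ≤ _ := h3
      _ = _ := by ring

theorem sumBound (w t : E → ℝ) (a : E) (M : ℝ) (ht0 : ∀ b, 0 ≤ t b) (ht1 : ∀ b, t b ≤ 1)
    (hmono : ∀ b c, a < b → b < c → w c ≤ w b * (1 - t b)) (F : Finset E) :
    (∀ b ∈ F, a < b ∧ w b ≤ M) →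
      ∑ b ∈ F, w b * t b ≤ M * (1 - ∏ z ∈ F, (1 - t z)) := by
  induction F using Finset.induction_on_max with
  | empty => intro _; simp
  | insert x F hx ih =>
    intro hF
    have hxF := hF x (Finset.mem_insert_self _ _)
    have hF' := fun b hb => hF b (Finset.mem_insert_of_mem hb)
    have h1 := ih hF'
    have hnot : x ∉ F := fun h => lt_irrefl _ (hx x h)
    have h2 := prodBound w t a M ht1 hmono F x hxF.1
      (fun b hb => ⟨(hF' b hb).1, hx b hb, (hF' b hb).2⟩) hxF.2
    rw [Finset.prod_insert hnot, Finset.sum_insert hnot]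
    have h3 := mul_le_mul_of_nonneg_right h2 (ht0 x)
    linarith

theorem sumBound' (w t : E → ℝ) (a : E) (M : ℝ) (hM : 0 ≤ M)
    (ht0 : ∀ b, 0 ≤ t b) (ht1 : ∀ b, t b ≤ 1)
    (hmono : ∀ b c, a < b → b < c → w c ≤ w b * (1 - t b)) (F : Finset E)
    (hF : ∀ b ∈ F, a < b ∧ w b ≤ M) : ∑ b ∈ F, w b * t b ≤ M := by
  refine (sumBound w t a M ht0 ht1 hmono F hF).trans ?_
  have : 0 ≤ ∏ z ∈ F, (1 - t z) := Finset.prod_nonneg fun z _ => sub_nonneg.2 (ht1 z)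
  nlinarith

theorem sumBoundDown (w t : E → ℝ) (a : E) (M : ℝ) (hM : 0 ≤ M)
    (ht0 : ∀ b, 0 ≤ t b) (ht1 : ∀ b, t b ≤ 1)
    (hmono : ∀ b c, c < b → b < a → w c ≤ w b * (1 - t b)) (F : Finset E)
    (hF : ∀ b ∈ F, b < a ∧ w b ≤ M) : ∑ b ∈ F, w b * t b ≤ M :=
  sumBound' (E := Eᵒᵈ) w t a M hM ht0 ht1 (fun b c h1 h2 => hmono b c h2 h1) F hF

theorem splitSum (f : E → ℝ) (a : E) (ha : f a = 0) (F : Finset E) :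
    ∑ b ∈ F, f b = ∑ b ∈ F with a < b, f b + ∑ b ∈ F with b < a, f b := by
  rw [Finset.sum_filter, Finset.sum_filter, ← Finset.sum_add_distrib]
  refine Finset.sum_congr rfl fun b _ => ?_
  rcases lt_trichotomy a b with h | h | h
  · simp [h, h.not_gt]
  · subst h; simp [ha]
  · simp [h, h.not_gt]

theorem symmLe (W : E → E → ℝ) (t : E → ℝ) (hW : ∀ a b, 0 ≤ W a b)
    (hdiag : ∀ a, W a a = 0) (hhalf : ∀ a b, W a b ≤ 1 / 2)
    (ht0 : ∀ b, 0 ≤ t b) (ht1 : ∀ b, t b ≤ 1)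
    (hup : ∀ a b c, a < b → b < c → W a c ≤ W a b * (1 - t b))
    (hdn : ∀ a b c, c < b → b < a → W a c ≤ W a b * (1 - t b))
    (hsum : ∀ a, HasSum (fun b => W a b * t b) 1) (a c : E) (hac : a < c) :
    W c a ≤ W a c := by
  have key : ∀ F : Finset E, ∑ b ∈ F, W a b * t b ≤ 1 - (W c a - W a c) := by
    intro F
    rw [splitSum _ a (by simp [hdiag]) F]
    have hlow : ∑ b ∈ F with b < a, W a b * t b ≤ 1 / 2 := by
      refine sumBoundDown (W a) t a (1/2) (by norm_num) ht0 ht1 (hdn a) _ ?_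
      intro b hb
      exact ⟨(Finset.mem_filter.1 hb).2, hhalf _ _⟩
    have hhigh : ∑ b ∈ F with a < b, W a b * t b ≤ 1 / 2 - (W c a - W a c) := by
      rw [← Finset.sum_filter_add_sum_filter_not _ (fun b => b < c)]
      set G := (F.filter (fun b => a < b)).filter (fun b => b < c) with hG
      have hGm : ∀ b ∈ G, a < b ∧ b < c := by
        intro b hb
        simp only [hG, Finset.mem_filter] at hb
        exact ⟨hb.1.2, hb.2⟩
      have h1 := sumBound (W a) t a (1/2) ht0 ht1 (hup a) G
        (fun b hb => ⟨(hGm b hb).1, hhalf _ _⟩)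
      have h2 : W c a ≤ 1 / 2 * ∏ z ∈ G, (1 - t z) :=
        prodBound (E := Eᵒᵈ) (W c) t c (1/2) ht1 (fun b d h1 h2 => hdn c b d h2 h1) G a hac
          (fun b hb => ⟨(hGm b hb).2, (hGm b hb).1, hhalf _ _⟩) (hhalf _ _)
      have h3 : ∑ b ∈ (F.filter (fun b => a < b)).filter (fun b => ¬ b < c), W a b * t b
          ≤ W a c := by
        refine sumBound' (W a) t a (W a c) (hW _ _) ht0 ht1 (hup a) _ ?_
        intro b hb
        simp only [Finset.mem_filter, not_lt] at hb
        refine ⟨hb.1.2, ?_⟩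
        rcases hb.2.eq_or_lt with h | h
        · rw [h]
        · have := hup a c b hac h
          have := mul_nonneg (hW a c) (ht0 c)
          linarith
      linarith
    linarith
  have := hasSum_le_of_sum_le (hsum a) key
  linarith

theorem halfSum (W : E → E → ℝ) (t : E → ℝ) (hW : ∀ a b, 0 ≤ W a b)
    (hdiag : ∀ a, W a a = 0) (hhalf : ∀ a b, W a b ≤ 1 / 2)
    (ht0 : ∀ b, 0 ≤ t b) (ht1 : ∀ b, t b ≤ 1)
    (hup : ∀ a b c, a < b → b < c → W a c ≤ W a b * (1 - t b))
    (hdn : ∀ a b c, c < b → b < a → W a c ≤ W a b * (1 - t b))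
    (hsum : ∀ a, HasSum (fun b => W a b * t b) 1) (a : E) :
    HasSum (fun b => if b < a then W a b * t b else 0) (1 / 2) := by
  have hs := (hsum a).summable
  have s1 : Summable (fun b => if b < a then W a b * t b else 0) := by
    refine Summable.of_nonneg_of_le (fun b => ?_) (fun b => ?_) hs
    · split_ifs; exacts [mul_nonneg (hW _ _) (ht0 _), le_rfl]
    · split_ifs; exacts [le_rfl, mul_nonneg (hW _ _) (ht0 _)]
  have s2 : Summable (fun b => if a < b then W a b * t b else 0) := by
    refine Summable.of_nonneg_of_le (fun b => ?_) (fun b => ?_) hs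
    · split_ifs; exacts [mul_nonneg (hW _ _) (ht0 _), le_rfl]
    · split_ifs; exacts [le_rfl, mul_nonneg (hW _ _) (ht0 _)]
  have e1 : ∑' b, (if b < a then W a b * t b else 0) ≤ 1 / 2 := by
    refine hasSum_le_of_sum_le s1.hasSum fun F => ?_
    rw [← Finset.sum_filter]
    refine sumBoundDown (W a) t a (1/2) (by norm_num) ht0 ht1 (hdn a) _ ?_
    intro b hb
    exact ⟨(Finset.mem_filter.1 hb).2, hhalf _ _⟩
  have e2 : ∑' b, (if a < b then W a b * t b else 0) ≤ 1 / 2 := by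
    refine hasSum_le_of_sum_le s2.hasSum fun F => ?_
    rw [← Finset.sum_filter]
    refine sumBound' (W a) t a (1/2) (by norm_num) ht0 ht1 (hup a) _ ?_
    intro b hb
    exact ⟨(Finset.mem_filter.1 hb).2, hhalf _ _⟩
  have h12 := s1.hasSum.add s2.hasSum
  have : (fun b => (if b < a then W a b * t b else 0) + (if a < b then W a b * t b else 0))
      = fun b => W a b * t b := by
    funext b
    rcases lt_trichotomy a b with h | h | h
    · simp [h, h.not_gt]
    · subst h; simp [hdiag]
    · simp [h, h.not_gt]
  rw [this] at h12
  have h := h12.unique (hsum a)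
  have : ∑' b, (if b < a then W a b * t b else 0) = 1 / 2 := by linarith
  rw [← this]
  exact s1.hasSum

end abstractOrder

open Scatter

variable {S : Type*}

theorem classFacts (R : Rep S) (D : Delineation R)
    (hbal : ∀ a, D.ωplus a = 1 / 2 ∧ D.ωminus a = 1 / 2) (a : S) :
    (∀ b, R.same a b → R.ω b (R.inv a) = R.ω a (R.inv b)) ∧
    ∑' c : {c : S // R.same a c ∧ D.lt c a}, R.ω a (R.inv c.1) * R.s (R.inv c.1) = 1 / 2 := by
  classical
  have srefl : ∀ x, R.same x x := fun x => Relation.EqvGen.refl x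
  have ssymm : ∀ {x y}, R.same x y → R.same y x := fun h => Relation.EqvGen.symm _ _ h
  have strans : ∀ {x y z}, R.same x y → R.same y z → R.same x z :=
    fun h1 h2 => Relation.EqvGen.trans _ _ _ h1 h2
  let E := {c : S // R.same a c}
  have hE : ∀ x y : E, R.same x.1 y.1 := fun x y => strans (ssymm x.2) y.2
  let r : E → E → Prop := fun x y => D.lt x.1 y.1
  haveI : IsStrictTotalOrder E r :=
    { irrefl := fun x => D.irrefl x.1
      trans := fun x y z => D.trans x.1 y.1 z.1
      trichotomous := fun x y h1 h2 => by
        rcases D.total x.1 y.1 (hE x y) with h | h | h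
        · exact Subtype.ext h
        · exact absurd h h1
        · exact absurd h h2 }
  letI : LinearOrder E := linearOrderOfSTO r
  have hlt : ∀ x y : E, x < y ↔ D.lt x.1 y.1 := fun x y => Iff.rfl
  let W : E → E → ℝ := fun x y => R.ω x.1 (R.inv y.1)
  let t : E → ℝ := fun x => R.s (R.inv x.1)
  have hW : ∀ x y, 0 ≤ W x y := fun x y => R.ω_nonneg _ _
  have hdiag : ∀ x, W x x = 0 := by
    intro x
    have h := R.p_inv x.1
    rw [R.p_eq] at h
    exact (mul_eq_zero.1 h).resolve_right (R.s_pos _).ne'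
  have hhalf : ∀ x y, W x y ≤ 1 / 2 := by
    intro x y
    rcases lt_trichotomy x y with h | h | h
    · rw [← (hbal x.1).1]
      refine le_csSup ⟨1, ?_⟩ ⟨y.1, hE x y, h, rfl⟩
      rintro _ ⟨b, _, _, rfl⟩
      exact R.ω_le_one _ _
    · subst h; rw [hdiag]; norm_num
    · rw [← (hbal x.1).2]
      refine le_csSup ⟨1, ?_⟩ ⟨y.1, hE x y, h, rfl⟩
      rintro _ ⟨b, _, _, rfl⟩
      exact R.ω_le_one _ _
  have ht0 : ∀ x, 0 ≤ t x := fun x => (R.s_pos _).le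
  have ht1 : ∀ x, t x ≤ 1 := fun x => R.s_le_one _
  have hup : ∀ x y z, x < y → y < z → W x z ≤ W x y * (1 - t y) := fun x y z h1 h2 =>
    D.compat_mono x.1 y.1 z.1 (hE x y) (hE y z) (Or.inl ⟨h1, h2⟩)
  have hdn : ∀ x y z, z < y → y < x → W x z ≤ W x y * (1 - t y) := fun x y z h1 h2 =>
    D.compat_mono x.1 y.1 z.1 (hE x y) (hE y z) (Or.inr ⟨h1, h2⟩)
  have hsum : ∀ x, HasSum (fun y => W x y * t y) 1 := by
    intro x
    let e : S ≃ S := ⟨R.inv, R.inv, R.inv_inv, R.inv_inv⟩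
    have h1 : HasSum (fun b => R.ω x.1 (R.inv b) * R.s (R.inv b)) 1 := by
      have := (e.hasSum_iff (f := R.p x.1) (a := 1)).2 (R.p_rowSum x.1)
      refine this.congr_fun ?_
      intro b
      exact (R.p_eq x.1 (R.inv b)).symm
    refine (hasSum_subtype_iff_of_support_subset (s := {c : S | R.same a c}) ?_).2 h1
    intro b hb
    have hne : R.ω x.1 (R.inv b) ≠ 0 := left_ne_zero_of_mul hb
    exact strans x.2 (Relation.EqvGen.rel _ _ (Or.inl ((R.ω_nonneg _ _).lt_of_ne' hne)))
  refine ⟨?_, ?_⟩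
  · intro b hb
    let x : E := ⟨a, srefl a⟩
    let y : E := ⟨b, hb⟩
    have hupS := symmLe W t hW hdiag hhalf ht0 ht1 hup hdn hsum
    have hdnS := symmLe (E := Eᵒᵈ) W t hW hdiag hhalf ht0 ht1
      (fun a b c h1 h2 => hdn a b c h2 h1) (fun a b c h1 h2 => hup a b c h2 h1) hsum
    change W y x = W x y
    rcases lt_trichotomy x y with h | h | h
    · exact le_antisymm (hupS x y h) (hdnS y x h)
    · rw [h]
    · exact le_antisymm (hdnS x y h) (hupS y x h)
  · let x : E := ⟨a, srefl a⟩
    have h := halfSum W t hW hdiag hhalf ht0 ht1 hup hdn hsum x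
    have h2 : ∑' y : {y : E // y < x}, W x y.1 * t y.1 = 1 / 2 := by
      rw [← h.tsum_eq]
      have := tsum_subtype {y : E | y < x} (fun y => W x y * t y)
      refine this.trans ?_
      refine tsum_congr fun y => ?_
      simp [Set.indicator_apply]
    rw [← h2]
    let e : {c : S // R.same a c ∧ D.lt c a} ≃ {y : E // y < x} :=
      ⟨fun c => ⟨⟨c.1, c.2.1⟩, c.2.2⟩, fun y => ⟨y.1.1, y.1.2, y.2⟩,
        fun _ => rfl, fun _ => rfl⟩
    exact e.tsum_eq (fun y : {y : E // y < x} => W x y.1 * t y.1)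

theorem kappaConst (R : Rep S) (D : Delineation R) (DB : DetailedBalance R)
    (hbal : ∀ a, D.ωplus a = 1 / 2 ∧ D.ωminus a = 1 / 2) {a b : S} (h : R.same a b) :
    DB.π a / R.s (R.inv a) = DB.π b / R.s (R.inv b) := by
  induction h with
  | rel x y hxy =>
    have hs := (classFacts R D hbal x).1 y (Relation.EqvGen.rel _ _ hxy)
    have hpos : 0 < R.ω x (R.inv y) := by
      rcases hxy with h | h
      · exact h
      · rwa [hs] at h
    have hb := DB.balance x y
    rw [R.p_eq, R.p_eq, hs] at hb
    rw [div_eq_div_iff (R.s_pos _).ne' (R.s_pos _).ne']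
    refine mul_left_cancel₀ hpos.ne' ?_
    linarith
  | refl x => rfl
  | symm x y _ ih => exact ih.symm
  | trans x y z _ _ h1 h2 => exact h1.trans h2

end ScatterAux

/-- Corollary `cor:through-prob`: for a balanced delineated scattering
representation satisfying dynamical detailed balance (hence automatically unbiased, so that
`κ(E) = π a / s ã` for any `a ∈ E`), one has
`κ(E) = 2 · ∑_{c ∈ E, c ≺ a} π c · ω c ã` for every `a ∈ E`. -/
theorem stmt10 {S : Type*} [Countable S] (R : Scatter.Rep S) (D : Scatter.Delineation R)
    (DB : Scatter.DetailedBalance R)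
    (hbal : ∀ a, D.ωplus a = 1 / 2 ∧ D.ωminus a = 1 / 2)
    (a : S) :
    DB.π a / R.s (R.inv a) =
      2 * ∑' c : {c : S // R.same a c ∧ D.lt c a}, DB.π c.1 * R.ω c.1 (R.inv a) := by
  have hk : ∀ c : {c : S // R.same a c ∧ D.lt c a}, DB.π c.1 * R.ω c.1 (R.inv a) =
      (DB.π a / R.s (R.inv a)) * (R.ω a (R.inv c.1) * R.s (R.inv c.1)) := by
    intro c
    rw [(ScatterAux.classFacts R D hbal a).1 c.1 c.2.1,
      ScatterAux.kappaConst R D DB hbal c.2.1]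
    have := (R.s_pos (R.inv c.1)).ne'
    field_simp
  rw [tsum_congr hk, tsum_mul_left, (ScatterAux.classFacts R D hbal a).2]
  ring
end

section
/- For a delineated abstract scattering representation of a non-lazy Markov transition matrix satisfying unbiased dynamical detailed balance with invariant measure π (not necessarily balanced): for every scattering class E and every a ∈ E, κ(E) = ∑_{c ∈ E, c ≠ a} π c · ω c ã; that is, κ(E) measures the total in-flow arriving at a from the other states of E. -/
open scoped BigOperators

/-- Equation `eq:kappa-meaning2`: for a delineated scattering
representation satisfying unbiased dynamical detailed balance (not necessarily balanced),
`κ(E) = ∑_{c ∈ E, c ≠ a} π c · ω c ã` for every `a ∈ E`, where `κ(E) = π a / s ã`. -/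
theorem stmt11 {S : Type*} [Countable S] (R : Scatter.Rep S) (D : Scatter.Delineation R)
    (DB : Scatter.DetailedBalance R) (hub : R.Unbiased) (a : S) :
    DB.π a / R.s (R.inv a) =
      ∑' c : {c : S // R.same a c ∧ c ≠ a}, DB.π c.1 * R.ω c.1 (R.inv a) := by
  have hs := R.s_pos (R.inv a)
  have hterm : ∀ c, DB.π c * R.ω c (R.inv a) =
      DB.π a / R.s (R.inv a) * R.p a (R.inv c) := by
    intro c
    have h := DB.balance a c
    rw [R.p_eq c (R.inv a)] at h
    rw [div_mul_eq_mul_div, h]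
    field_simp
  have hsum : HasSum (fun c => R.p a (R.inv c)) 1 := by
    let e : S ≃ S := ⟨R.inv, R.inv, R.inv_inv, R.inv_inv⟩
    exact (Equiv.hasSum_iff e).2 (R.p_rowSum a)
  have hsub : HasSum (fun c : {c : S | R.same a c ∧ c ≠ a} => R.p a (R.inv c.1)) 1 := by
    refine (hasSum_subtype_iff_of_support_subset
      (f := fun c => R.p a (R.inv c)) ?_).2 hsum
    intro c hc
    have hc' : R.p a (R.inv c) ≠ 0 := hc
    refine ⟨Relation.EqvGen.rel _ _ (Or.inl ?_), ?_⟩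
    · refine lt_of_le_of_ne (R.ω_nonneg _ _) ?_
      intro h0
      apply hc'
      rw [R.p_eq, ← h0, zero_mul]
    · rintro rfl
      exact hc' (R.p_inv _)
  have hfin := hsub.mul_left (DB.π a / R.s (R.inv a))
  rw [mul_one] at hfin
  simp only [hterm]
  exact hfin.tsum_eq.symm
end

section
/- (Kesten–Spitzer–Whitman range theorem, real-valued case.) Let (Ω, μ) be a probability space, T : Ω → Ω a measure-preserving ergodic transformation, and f : Ω → ℝ an integrable function with ∫ f dμ = 0. Define the Birkhoff sums W_n = ∑_{k=0}^{n−1} f ∘ T^k (so W_0 = 0). Then for every ε > 0, for μ-almost every ω the set {n ≥ 1 : |W_n(ω)| ≤ ε} is infinite; that is, the partial-sum process almost surely returns to within ε of its starting value infinitely often. -/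
open MeasureTheory

lemma ks_integral_comp {Ω : Type*} [MeasurableSpace Ω] {μ : Measure Ω} {T : Ω → Ω}
    (hT : MeasurePreserving T μ μ) {g : Ω → ℝ} (hg : AEStronglyMeasurable g μ) :
    ∫ ω, g (T ω) ∂μ = ∫ ω, g ω ∂μ := by
  have h := integral_map (μ := μ) hT.measurable.aemeasurable (f := g) (by rwa [hT.map_eq])
  rw [hT.map_eq] at h
  exact h.symm

/-- mean ergodic theorem for bounded functions, in L1 form -/
lemma ks_mean {Ω : Type*} [MeasurableSpace Ω] (μ : Measure Ω)
    [IsProbabilityMeasure μ] (T : Ω → Ω) (hT : Ergodic T μ)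
    (g : Ω → ℝ) (hg : MemLp g 2 μ) (hmean : ∫ ω, g ω ∂μ = 0)
    (δ : ℝ) (hδ : 0 < δ) :
    ∃ n : ℕ, 1 ≤ n ∧ ∫ ω, |(n : ℝ)⁻¹ * ∑ k ∈ Finset.range n, g (T^[k] ω)| ∂μ ≤ δ := by
  have hmp := hT.toMeasurePreserving
  let U : Lp ℝ 2 μ →ₗᵢ[ℝ] Lp ℝ 2 μ := Lp.compMeasurePreservingₗᵢ ℝ T hmp
  have h1 := U.toContinuousLinearMap.tendsto_birkhoffAverage_orthogonalProjection
    U.norm_toContinuousLinearMap_le hg.toLp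
  have h0 : (U.toContinuousLinearMap.eqLocus (1 : Lp ℝ 2 μ →L[ℝ] Lp ℝ 2 μ)).orthogonalProjectionOnto
      hg.toLp = 0 := by
    rw [Submodule.orthogonalProjectionOnto_eq_zero_iff]
    intro v hv
    have hv' : Lp.compMeasurePreserving T hmp v = v := hv
    have hvc : (v : Ω → ℝ) ∘ T =ᵐ[μ] v := by
      have := Lp.coeFn_compMeasurePreserving v hmp
      rw [hv'] at this
      exact this.symm
    obtain ⟨c, hc⟩ := hT.ae_eq_const_of_ae_eq_comp_ae (Lp.aestronglyMeasurable v) hvc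
    rw [L2.inner_def]
    have : ∫ a, inner ℝ (v a) (hg.toLp g a) ∂μ = ∫ a, c * g a ∂μ := by
      apply integral_congr_ae
      filter_upwards [hc, hg.coeFn_toLp] with a ha hb
      rw [ha, hb]; simp [mul_comm]
    rw [this, integral_const_mul, hmean, mul_zero]
  rw [h0] at h1
  have h2 := (Metric.tendsto_atTop.1 h1) δ hδ
  obtain ⟨N, hN⟩ := h2
  refine ⟨N + 1, by omega, ?_⟩
  have h3 := hN (N + 1) (by omega)
  set n := N + 1
  have hmem : ∀ k, MemLp (fun ω => g (T^[k] ω)) 2 μ := fun k =>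
    hg.comp_measurePreserving (hmp.iterate k)
  have hA : MemLp (fun ω => (n : ℝ)⁻¹ * ∑ k ∈ Finset.range n, g (T^[k] ω)) 2 μ :=
    (memLp_finsetSum _ fun k _ => hmem k).const_mul _
  have h4 : birkhoffAverage ℝ U.toContinuousLinearMap id n hg.toLp = hA.toLp := by
    apply Lp.ext
    refine Filter.EventuallyEq.trans ?_ hA.coeFn_toLp.symm
    have hit : ∀ k, (((U.toContinuousLinearMap)^[k] hg.toLp : Lp ℝ 2 μ) : Ω → ℝ) =ᵐ[μ]
        fun ω => g (T^[k] ω) := by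
      intro k
      have e : (U.toContinuousLinearMap)^[k] hg.toLp
          = Lp.compMeasurePreserving (T^[k]) (hmp.iterate k) hg.toLp := by
        rw [← Lp.compMeasurePreserving_iterate]; rfl
      rw [e, Lp.toLp_compMeasurePreserving]
      exact MemLp.coeFn_toLp _
    simp only [birkhoffAverage, birkhoffSum, id]
    refine (Lp.coeFn_smul _ _).trans ?_
    filter_upwards [Lp.coeFn_finsetSum (Finset.range n) (fun k => (U.toContinuousLinearMap)^[k] hg.toLp), ae_all_iff.2 hit] with ω h5 h6
    simp only [Pi.smul_apply, smul_eq_mul, h5, Finset.sum_apply, h6]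
  rw [h4] at h3
  simp only [ZeroMemClass.coe_zero, dist_zero_right, Lp.norm_toLp] at h3
  have h5 : eLpNorm (fun ω => (n : ℝ)⁻¹ * ∑ k ∈ Finset.range n, g (T^[k] ω)) 1 μ ≤ _ :=
    eLpNorm_le_eLpNorm_of_exponent_le (by norm_num : (1 : ENNReal) ≤ 2) hA.1
  have h6 := ENNReal.toReal_mono hA.2.ne h5
  have h7 := (hA.integrable (by norm_num)).norm
  have h8 := integral_norm_eq_lintegral_enorm hA.1
  rw [eLpNorm_one_eq_lintegral_enorm, ← h8] at h6
  exact h6.trans h3.le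

lemma ks_card (S : Finset ℕ) (W : ℕ → ℝ) (ε M : ℝ) (hε : 0 < ε)
    (hsep : ∀ m ∈ S, ∀ n ∈ S, m < n → ε < |W n - W m|) (hM : ∀ n ∈ S, |W n| ≤ M) (hM0 : 0 ≤ M) :
    (S.card : ℝ) ≤ 2 / ε * M + 2 := by
  have hmaps : Set.MapsTo (fun n => ⌊W n / ε⌋) S (Finset.Icc ⌊-M / ε⌋ ⌊M / ε⌋ : Finset ℤ) := by
    intro n hn
    have := abs_le.1 (hM n hn)
    simp only [Finset.coe_Icc, Set.mem_Icc]
    constructor <;> apply Int.floor_le_floor <;> apply div_le_div_of_nonneg_right _ hε.le <;> linarith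
  have hlt : ∀ m ∈ S, ∀ n ∈ S, m < n → ⌊W m / ε⌋ ≠ ⌊W n / ε⌋ := by
    intro m hm n hn hmn h
    have h1 := hsep m hm n hn hmn
    have h2 := Int.abs_sub_lt_one_of_floor_eq_floor h
    rw [← sub_div, abs_div, abs_of_pos hε, div_lt_one hε, abs_sub_comm] at h2
    linarith
  have hinj : Set.InjOn (fun n => ⌊W n / ε⌋) S := by
    intro m hm n hn h
    rcases lt_trichotomy m n with h' | h' | h'
    · exact absurd h (hlt m hm n hn h')
    · exact h'
    · exact absurd h.symm (hlt n hn m hm h')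
  have hc := Finset.card_le_card_of_injOn _ hmaps hinj
  rw [Int.card_Icc] at hc
  have h1 : ⌊-M / ε⌋ ≤ ⌊M / ε⌋ :=
    Int.floor_le_floor (div_le_div_of_nonneg_right (by linarith) hε.le)
  have h2 : (S.card : ℤ) ≤ ⌊M / ε⌋ + 1 - ⌊-M / ε⌋ := by omega
  have h3 : (S.card : ℝ) ≤ ⌊M / ε⌋ + 1 - ⌊-M / ε⌋ := by exact_mod_cast h2
  have h4 := Int.floor_le (M / ε)
  have h5 := Int.lt_floor_add_one (-M / ε)
  have h6 : 2 / ε * M = M / ε - (-M / ε) := by ring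
  linarith

lemma ks_decomp {Ω : Type*} [MeasurableSpace Ω] (μ : Measure Ω)
    [IsProbabilityMeasure μ] (T : Ω → Ω) (hT : Ergodic T μ)
    (f : Ω → ℝ) (hf : Integrable f μ) (hmean : ∫ ω, f ω ∂μ = 0)
    (δ : ℝ) (hδ : 0 < δ) :
    ∃ (h : Ω → ℝ) (C : ℝ), Measurable h ∧ (∀ ω, |h ω| ≤ C) ∧
      ∫ ω, |f ω - (h ω - h (T ω))| ∂μ ≤ δ := by
  have hmp := hT.toMeasurePreserving
  obtain ⟨s, hs, hs1⟩ := (memLp_one_iff_integrable.2 hf).exists_simpleFunc_eLpNorm_sub_lt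
    ENNReal.one_ne_top (ε := ENNReal.ofReal (δ / 3)) (by simpa using hδ)
  have hsi : Integrable s μ := memLp_one_iff_integrable.1 hs1
  have hs2 : ∫ ω, |f ω - s ω| ∂μ ≤ δ / 3 := by
    have h8 := integral_norm_eq_lintegral_enorm (hf.sub hsi).1
    have h9 : ∫ ω, ‖(f - ⇑s) ω‖ ∂μ ≤ δ / 3 := by
      rw [h8, ← eLpNorm_one_eq_lintegral_enorm]
      exact ENNReal.toReal_le_of_le_ofReal (by linarith) hs.le
    exact h9
  set c := ∫ ω, s ω ∂μ with hc
  have hc3 : |c| ≤ δ / 3 := by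
    have : c = - ∫ ω, (f ω - s ω) ∂μ := by
      rw [integral_sub hf hsi, hmean]; ring
    rw [this, abs_neg]
    exact (abs_integral_le_integral_abs).trans hs2
  let g : Ω → ℝ := fun ω => s ω - c
  have hgm : Measurable g := s.measurable.sub_const c
  obtain ⟨B, hB⟩ := s.exists_forall_norm_le
  have hgb : ∀ ω, |g ω| ≤ B + |c| := fun ω =>
    (abs_sub _ _).trans (add_le_add (hB ω) le_rfl)
  have hg2 : MemLp g 2 μ := MemLp.of_bound hgm.aestronglyMeasurable (B + |c|)
    (Filter.Eventually.of_forall hgb)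
  have hg0 : ∫ ω, g ω ∂μ = 0 := by
    simp only [g]
    rw [integral_sub hsi (integrable_const _)]; simp [hc]
  obtain ⟨n, hn, hn3⟩ := ks_mean μ T hT g hg2 hg0 (δ / 3) (by linarith)
  have hn0 : (n : ℝ) ≠ 0 := by positivity
  have hgk : ∀ k, Measurable fun ω => g (T^[k] ω) := fun k =>
    hgm.comp (hT.measurable.iterate k)
  let h : Ω → ℝ := fun ω => (n : ℝ)⁻¹ * ∑ k ∈ Finset.range n, birkhoffSum T g k ω
  have hcob : ∀ ω, h ω - h (T ω) = g ω - (n : ℝ)⁻¹ * ∑ k ∈ Finset.range n, g (T^[k] ω) := by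
    intro ω
    simp only [h]
    rw [← mul_sub, ← Finset.sum_sub_distrib]
    have : ∀ k ∈ Finset.range n, birkhoffSum T g k ω - birkhoffSum T g k (T ω)
        = g ω - g (T^[k] ω) := by
      intro k _
      have := birkhoffSum_apply_sub_birkhoffSum T g k ω
      linarith
    rw [Finset.sum_congr rfl this, Finset.sum_sub_distrib, mul_sub]
    simp [hn0]
  refine ⟨h, (n : ℝ)⁻¹ * ∑ k ∈ Finset.range n, ∑ j ∈ Finset.range k, (B + |c|), ?_, ?_, ?_⟩
  · apply Measurable.const_mul
    apply Finset.measurable_fun_sum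
    intro k _
    exact Finset.measurable_fun_sum _ fun j _ => hgk j
  · intro ω
    simp only [h]
    rw [abs_mul, abs_of_nonneg (by positivity : (0:ℝ) ≤ (n : ℝ)⁻¹)]
    gcongr
    refine (Finset.abs_sum_le_sum_abs _ _).trans (Finset.sum_le_sum fun k _ => ?_)
    exact (Finset.abs_sum_le_sum_abs _ _).trans (Finset.sum_le_sum fun j _ => hgb _)
  · have hAi : Integrable (fun ω => (n : ℝ)⁻¹ * ∑ k ∈ Finset.range n, g (T^[k] ω)) μ :=
      (integrable_finsetSum _ fun k _ =>
        (hmp.iterate k).integrable_comp_of_integrable (hg2.integrable (by norm_num))).const_mul _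
    have i1 : Integrable (fun ω => |f ω - s ω|) μ := (hf.sub hsi).abs
    calc _ ≤ ∫ ω, (|f ω - s ω| + |c| + |(n : ℝ)⁻¹ * ∑ k ∈ Finset.range n, g (T^[k] ω)|) ∂μ := by
          apply integral_mono_of_nonneg (Filter.Eventually.of_forall fun _ => abs_nonneg _)
          · exact (i1.add (integrable_const _)).add hAi.abs
          · refine Filter.Eventually.of_forall fun ω => ?_
            simp only [hcob]
            have : f ω - (g ω - (n : ℝ)⁻¹ * ∑ k ∈ Finset.range n, g (T^[k] ω))
              = (f ω - s ω) + c + (n : ℝ)⁻¹ * ∑ k ∈ Finset.range n, g (T^[k] ω) := by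
              simp only [g]; ring
            rw [this]
            exact abs_add_three _ _ _
      _ ≤ δ := by
          have i2 : Integrable (fun ω => |f ω - s ω| + |c|) μ := i1.add (integrable_const _)
          rw [integral_add i2 hAi.abs, integral_add i1 (integrable_const _)]
          simp only [integral_const, probReal_univ, one_smul]
          linarith

lemma ks_null {Ω : Type*} [MeasurableSpace Ω] (μ : Measure Ω)
    [IsProbabilityMeasure μ] (T : Ω → Ω) (hT : Ergodic T μ)
    (f : Ω → ℝ) (hfm : Measurable f) (hf : Integrable f μ) (hmean : ∫ ω, f ω ∂μ = 0)
    (ε : ℝ) (hε : 0 < ε) :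
    ∀ᵐ ω ∂μ, ∃ n, 1 ≤ n ∧ |birkhoffSum T f n ω| ≤ ε := by
  classical
  have hmp := hT.toMeasurePreserving
  set A : Set Ω := {ω | ¬ ∃ n, 1 ≤ n ∧ |birkhoffSum T f n ω| ≤ ε} with hA
  have hWm : ∀ n, Measurable fun ω => birkhoffSum T f n ω := fun n =>
    Finset.measurable_fun_sum _ fun j _ => hfm.comp (hT.measurable.iterate j)
  have hAm : MeasurableSet A := by
    have : A = (⋃ n : ℕ, ⋃ _ : 1 ≤ n, {ω | |birkhoffSum T f n ω| ≤ ε})ᶜ := by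
      ext ω; simp [hA]
    rw [this]
    exact (MeasurableSet.iUnion fun n => MeasurableSet.iUnion fun _ =>
      measurableSet_le (hWm n).abs measurable_const).compl
  have key : ∀ δ > 0, μ.real A ≤ 2 / ε * δ := by
    intro δ hδ
    obtain ⟨h, C, hhm, hC, hr⟩ := ks_decomp μ T hT f hf hmean δ hδ
    set r : Ω → ℝ := fun ω => |f ω - (h ω - h (T ω))| with hrdef
    have hhi : Integrable h μ := Integrable.of_bound hhm.aestronglyMeasurable C
      (Filter.Eventually.of_forall hC)
    have hri : Integrable r μ :=
      (hf.sub (hhi.sub (hmp.integrable_comp_of_integrable hhi))).abs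
    have main : ∀ (N : ℕ) ω, ∑ k ∈ Finset.range N, A.indicator (fun _ => (1 : ℝ)) (T^[k] ω)
        ≤ 2 / ε * (2 * C + ∑ k ∈ Finset.range N, r (T^[k] ω)) + 2 := by
      intro N ω
      have hC0 : 0 ≤ C := (abs_nonneg _).trans (hC ω)
      have hcard := ks_card ((Finset.range N).filter fun k => T^[k] ω ∈ A)
        (fun k => birkhoffSum T f k ω) ε (2 * C + ∑ k ∈ Finset.range N, r (T^[k] ω)) hε ?_ ?_ ?_
      · refine le_trans (le_of_eq ?_) hcard
        rw [Finset.card_filter]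
        push_cast
        refine Finset.sum_congr rfl fun k _ => ?_
        by_cases hk : T^[k] ω ∈ A
        · rw [Set.indicator_of_mem hk, if_pos hk]
        · rw [Set.indicator_of_notMem hk, if_neg hk]
      · intro m hm n hn hmn
        have hmA : T^[m] ω ∈ A := (Finset.mem_filter.1 hm).2
        obtain ⟨d, rfl⟩ := Nat.exists_eq_add_of_lt hmn
        simp only [hA, Set.mem_ofPred_eq, not_exists, not_and, not_le] at hmA
        have := hmA (d + 1) (by omega)
        rw [add_assoc, birkhoffSum_add]
        simpa using this
      · intro n hn
        have hnN : n < N := Finset.mem_range.1 (Finset.mem_filter.1 hn).1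
        have htel : birkhoffSum T f n ω = (h ω - h (T^[n] ω)) +
            ∑ k ∈ Finset.range n, (f (T^[k] ω) - (h (T^[k] ω) - h (T (T^[k] ω)))) := by
          rw [Finset.sum_sub_distrib]
          simp only [← Function.iterate_succ_apply' T]
          rw [Finset.sum_range_sub' (fun k => h (T^[k] ω))]
          simp [birkhoffSum]
        rw [htel]
        refine (abs_add_le _ _).trans (add_le_add ?_ ?_)
        · refine (abs_sub _ _).trans ?_
          linarith [hC ω, hC (T^[n] ω)]
        · refine (Finset.abs_sum_le_sum_abs _ _).trans ?_
          exact Finset.sum_le_sum_of_subset_of_nonneg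
            (Finset.range_subset_range.2 hnN.le) fun _ _ _ => abs_nonneg _
      · exact add_nonneg (by linarith) (Finset.sum_nonneg fun _ _ => abs_nonneg _)
    have bound : ∀ N : ℕ, N * μ.real A ≤ 2 / ε * (2 * C + N * δ) + 2 := by
      intro N
      have hAi : Integrable (A.indicator (fun _ => (1 : ℝ))) μ := (integrable_const _).indicator hAm
      have hAk : ∀ k, Integrable (fun ω => A.indicator (fun _ => (1 : ℝ)) (T^[k] ω)) μ :=
        fun k => (hmp.iterate k).integrable_comp_of_integrable hAi
      have hrk : ∀ k, Integrable (fun ω => r (T^[k] ω)) μ :=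
        fun k => (hmp.iterate k).integrable_comp_of_integrable hri
      have hrs : Integrable (fun ω => ∑ k ∈ Finset.range N, r (T^[k] ω)) μ :=
        integrable_finsetSum _ fun k _ => hrk k
      have i1 : Integrable (fun ω => 2 / ε * (2 * C + ∑ k ∈ Finset.range N, r (T^[k] ω))) μ :=
        ((integrable_const _).add hrs).const_mul _
      have hm := integral_mono (integrable_finsetSum _ fun k _ => hAk k)
        (i1.add (integrable_const _)) (main N)
      rw [integral_finsetSum _ fun k _ => hAk k] at hm
      simp only [Pi.add_apply] at hm
      rw [integral_add i1 (integrable_const _), integral_const_mul,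
        integral_add (integrable_const _) hrs, integral_finsetSum _ fun k _ => hrk k] at hm
      simp only [ks_integral_comp (hmp.iterate _) hAi.1, ks_integral_comp (hmp.iterate _) hri.1,
        Finset.sum_const, Finset.card_range, nsmul_eq_mul,
        integral_const, probReal_univ, one_smul] at hm
      rw [integral_indicator_const _ hAm] at hm
      simp only [smul_eq_mul, mul_one] at hm
      refine hm.trans ?_
      gcongr
    by_contra hcon
    push Not at hcon
    obtain ⟨N, hN⟩ := exists_nat_gt ((2 / ε * (2 * C) + 2) / (μ.real A - 2 / ε * δ))
    rw [div_lt_iff₀ (by linarith)] at hN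
    have := bound N
    nlinarith
  have h0 : μ.real A ≤ 0 := by
    apply le_of_forall_pos_le_add
    intro η hη
    have := key (ε / 2 * η) (by positivity)
    have e : 2 / ε * (ε / 2 * η) = η := by field_simp
    linarith
  have h1 : μ.real A = 0 := le_antisymm h0 measureReal_nonneg
  rw [ae_iff]
  exact (measureReal_eq_zero_iff).1 h1

lemma ks_step {Ω : Type*} (T : Ω → Ω) (f : Ω → ℝ) (ε : ℝ) (N : ℕ) :
    ∀ (j : ℕ) (ω : Ω), (∀ j k : ℕ, ∃ n, 1 ≤ n ∧ |birkhoffSum T f n (T^[k] ω)| ≤ ε / 2 ^ j) →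
    ∃ n, N < n ∧ |birkhoffSum T f n ω| ≤ ε / 2 ^ j := by
  induction N with
  | zero => intro j ω h; obtain ⟨n, hn, h'⟩ := h j 0; exact ⟨n, hn, h'⟩
  | succ N ih =>
    intro j ω h
    obtain ⟨n, hn, h1⟩ := h (j + 1) 0
    obtain ⟨m, hm, h2⟩ := ih (j + 1) (T^[n] ω) (fun j k => by
      rw [← Function.iterate_add_apply]; exact h j _)
    refine ⟨n + m, by omega, ?_⟩
    rw [birkhoffSum_add]
    refine (abs_add_le _ _).trans ?_
    have e : ε / 2 ^ j = ε / 2 ^ (j + 1) + ε / 2 ^ (j + 1) := by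
      rw [pow_succ]; field_simp; ring
    rw [e]
    exact add_le_add h1 h2

theorem stmt13 {Ω : Type*} [MeasurableSpace Ω] (μ : Measure Ω)
    [IsProbabilityMeasure μ] (T : Ω → Ω) (hT : Ergodic T μ)
    (f : Ω → ℝ) (hf : Integrable f μ) (hmean : ∫ ω, f ω ∂μ = 0)
    (ε : ℝ) (hε : 0 < ε) :
    ∀ᵐ ω ∂μ,
      {n : ℕ | 1 ≤ n ∧ |∑ k ∈ Finset.range n, f (T^[k] ω)| ≤ ε}.Infinite := by
  have hq : ∀ k, Measure.QuasiMeasurePreserving (T^[k]) μ μ := fun k =>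
    (hT.toMeasurePreserving.iterate k).quasiMeasurePreserving
  obtain ⟨g, hgm, hfg⟩ : ∃ g, Measurable g ∧ f =ᵐ[μ] g :=
    ⟨hf.1.mk f, hf.1.stronglyMeasurable_mk.measurable, hf.1.ae_eq_mk⟩
  have hgi : Integrable g μ := hf.congr hfg
  have hg0 : ∫ ω, g ω ∂μ = 0 := by rw [← integral_congr_ae hfg, hmean]
  have h1 : ∀ᵐ ω ∂μ, ∀ k, f (T^[k] ω) = g (T^[k] ω) :=
    ae_all_iff.2 fun k => (hq k).ae hfg
  have h2 : ∀ᵐ ω ∂μ, ∀ j k : ℕ, ∃ n, 1 ≤ n ∧ |birkhoffSum T g n (T^[k] ω)| ≤ ε / 2 ^ j :=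
    ae_all_iff.2 fun j => ae_all_iff.2 fun k =>
      (hq k).ae (ks_null μ T hT g hgm hgi hg0 (ε / 2 ^ j) (by positivity))
  filter_upwards [h1, h2] with ω hω1 hω2
  rw [Set.infinite_iff_exists_gt]
  intro N
  obtain ⟨n, hn, h⟩ := ks_step T g ε N 0 ω hω2
  refine ⟨n, ⟨by omega, ?_⟩, hn⟩
  simp only [hω1]
  simpa [birkhoffSum] using h
end
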